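/- Let q ≥ 7 be a prime power, F a finite field with q^2 elements, and G ∈ F[x_0,...,x_4] a nonzero homogeneous polynomial of degree 3. Suppose that: some generator of V_3 is contained in V(G)(F); no plane of ℙ^4(F) is contained in V(G)(F); and for every plane Π of ℙ^4(F), at most two generators of V_3 are contained in Π ∩ V(G)(F). Then |V(G)(F) ∩ V_3| < 3(q^5 + q^2) + q^3 + 1. -/

import Mathlib

open MvPolynomial

noncomputable section

/-- The projective space ℙ⁴(F): 1-dimensional F-linear subspaces of F⁵. -/
abbrev P4 (F : Type) [Field F] := Projectivization F (Fin 5 → F)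

/-- The non-degenerate Hermitian threefold
    V₃ = {[x] ∈ ℙ⁴(F) : x₀^{q+1} + ⋯ + x₄^{q+1} = 0}. -/
def hermV3 (q : ℕ) (F : Type) [Field F] : Set (P4 F) :=
  {x | ∑ i, x.rep i ^ (q + 1) = 0}

/-- V(G)(F) = {[x] ∈ ℙ⁴(F) : G(x) = 0}, for G homogeneous this is well defined. -/
def VG {F : Type} [Field F] (G : MvPolynomial (Fin 5) F) : Set (P4 F) :=
  {x | eval x.rep G = 0}

/-- The set of points of ℙ⁴(F) contained in an F-linear subspace of F⁵ of dimension k. -/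
def IsLinSub (F : Type) [Field F] (k : ℕ) (S : Set (P4 F)) : Prop :=
  ∃ W : Submodule F (Fin 5 → F), Module.finrank F W = k ∧
    S = {x : P4 F | x.submodule ≤ W}

/-- A line of ℙ⁴(F). -/
def IsLine (F : Type) [Field F] (S : Set (P4 F)) : Prop := IsLinSub F 2 S

/-- A plane of ℙ⁴(F). -/
def IsPlane (F : Type) [Field F] (S : Set (P4 F)) : Prop := IsLinSub F 3 S

/-- A hyperplane of ℙ⁴(F). -/
def IsHyperplane (F : Type) [Field F] (S : Set (P4 F)) : Prop := IsLinSub F 4 S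

/-- The tangent hyperplane T_P(V₃) = {[x] : a₀^q x₀ + ⋯ + a₄^q x₄ = 0} where P = [a]. -/
def tangentHyp (q : ℕ) {F : Type} [Field F] (P : P4 F) : Set (P4 F) :=
  {x | ∑ i, P.rep i ^ q * x.rep i = 0}

/-- A subset of ℙ⁴(F) is a tangent hyperplane to V₃ if it equals T_P(V₃) for some P ∈ V₃. -/
def IsTangentHyp (q : ℕ) {F : Type} [Field F] (S : Set (P4 F)) : Prop :=
  ∃ P ∈ hermV3 q F, S = tangentHyp q P

section FiniteField

variable {F : Type} [Field F] {q : ℕ}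

theorem add_pow_of_card_eq_sq [Fintype F] (hq : IsPrimePow q) (hF : Fintype.card F = q ^ 2)
    (x y : F) : (x + y) ^ q = x ^ q + y ^ q := by
  obtain ⟨p, k, hp, hk, rfl⟩ := hq
  have hp' : p.Prime := hp.nat_prime
  obtain ⟨r, hr⟩ := CharP.exists F
  obtain ⟨n, hrp, hn⟩ := FiniteField.card F r
  have hpr : p = r := by
    have h1 : p ∣ r ^ (n : ℕ) := by
      rw [← hn, hF, ← pow_mul]
      exact dvd_pow_self p (by positivity)
    exact (Nat.prime_dvd_prime_iff_eq hp' hrp).1 (hp'.dvd_of_dvd_pow h1)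
  subst hpr
  have := Fact.mk hp'
  exact add_pow_char_pow x y p k

theorem pow_pow_of_card_eq_sq [Fintype F] (hF : Fintype.card F = q ^ 2) (x : F) :
    (x ^ q) ^ q = x := by
  rw [← pow_mul, ← sq, ← hF, FiniteField.pow_card]

theorem neg_one_pow_of_add_pow (hq0 : q ≠ 0) (hadd : ∀ x y : F, (x + y) ^ q = x ^ q + y ^ q) :
    (-1 : F) ^ q = -1 := by
  have := hadd 1 (-1)
  rw [add_neg_cancel, zero_pow hq0, one_pow] at this
  linear_combination -this

theorem card_le_natDegree_of_forall_eval_eq_zero {p : Polynomial F} (hp : p ≠ 0) (S : Finset F)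
    (h : ∀ x ∈ S, p.eval x = 0) : S.card ≤ p.natDegree := by
  classical
  refine Polynomial.card_le_degree_of_subset_roots (p := p) ?_
  intro x hx
  exact (Polynomial.mem_roots hp).2 (h x hx)

theorem card_pow_add_self_le (hq : 2 ≤ q) (c : F) (S : Finset F)
    (h : ∀ x ∈ S, x ^ q + x = c) : S.card ≤ q := by
  have hd : (Polynomial.X ^ q + (Polynomial.X - Polynomial.C c) : Polynomial F).natDegree = q := by
    rw [Polynomial.natDegree_add_eq_left_of_natDegree_lt] <;> simp; omega
  have hne : (Polynomial.X ^ q + (Polynomial.X - Polynomial.C c) : Polynomial F) ≠ 0 := by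
    rintro h0
    rw [h0] at hd
    simp at hd
    omega
  refine (card_le_natDegree_of_forall_eval_eq_zero hne S fun x hx => ?_).trans hd.le
  simp [← h x hx]

/-- A rational function `K / Q` cannot satisfy `r ^ q + r = E` when `E` has degree `q + 1`. -/
theorem normEq_ne_zero (hq : 2 ≤ q) {E K Q : Polynomial F} (hE : E.natDegree = q + 1)
    (hQ : Q ≠ 0) : E * Q ^ (q + 1) - (K ^ q * Q + K * Q ^ q) ≠ 0 := by
  intro h
  have hE0 : E ≠ 0 := by
    rintro rfl
    simp at hE
  have h1 : E * Q ^ (q + 1) = K ^ q * Q + K * Q ^ q := sub_eq_zero.1 h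
  have hdeg : (E * Q ^ (q + 1)).natDegree = (q + 1) + (q + 1) * Q.natDegree := by
    rw [Polynomial.natDegree_mul hE0 (pow_ne_zero _ hQ), Polynomial.natDegree_pow, hE]
  have hl : (K ^ q * Q).natDegree ≤ q * K.natDegree + Q.natDegree :=
    Polynomial.natDegree_mul_le.trans (by rw [Polynomial.natDegree_pow])
  have hr : (K * Q ^ q).natDegree ≤ K.natDegree + q * Q.natDegree :=
    Polynomial.natDegree_mul_le.trans (by rw [Polynomial.natDegree_pow])
  rcases le_or_gt K.natDegree Q.natDegree with hKQ | hKQ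
  · have h2 := Polynomial.natDegree_add_le (K ^ q * Q) (K * Q ^ q)
    rw [← h1, hdeg] at h2
    have h3 : q * K.natDegree ≤ q * Q.natDegree := Nat.mul_le_mul_left _ hKQ
    have h4 : max (K ^ q * Q).natDegree (K * Q ^ q).natDegree ≤ q * Q.natDegree + Q.natDegree :=
      max_le (by omega) (by omega)
    have h5 : (q + 1) * Q.natDegree = q * Q.natDegree + Q.natDegree := by ring
    omega
  · have hK0 : K ≠ 0 := by
      rintro rfl
      simp at hKQ
    have hl' : (K ^ q * Q).natDegree = q * K.natDegree + Q.natDegree := by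
      rw [Polynomial.natDegree_mul (pow_ne_zero _ hK0) hQ, Polynomial.natDegree_pow]
    have hlt : (K * Q ^ q).natDegree < (K ^ q * Q).natDegree := by
      obtain ⟨m, hm⟩ := Nat.exists_eq_add_of_lt hKQ
      obtain ⟨r, rfl⟩ := Nat.exists_eq_add_of_le hq
      rw [hl']
      refine hr.trans_lt ?_
      rw [hm]
      nlinarith
    have h2 := Polynomial.natDegree_add_eq_left_of_natDegree_lt hlt
    rw [← h1, hdeg, hl'] at h2
    have h3 : q * K.natDegree = q * (Q.natDegree + 1) + 1 := by
      have : q * (Q.natDegree + 1) = q * Q.natDegree + q := by ring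
      have : (q + 1) * Q.natDegree = q * Q.natDegree + Q.natDegree := by ring
      omega
    have h4 : q ∣ 1 := by
      have h5 : q ∣ q * (Q.natDegree + 1) + 1 := h3 ▸ dvd_mul_right q _
      exact (Nat.dvd_add_right (dvd_mul_right q _)).1 h5
    have := Nat.le_of_dvd one_pos h4
    omega

/-- The curve `x Q(y) = K(y)` meets the Hermitian curve `x ^ q + x = E(y)` above at most
`3 q + 3` values of `y`. -/
theorem card_rational_inter_le (hq : 2 ≤ q) {E K Q : Polynomial F} (hE : E.natDegree = q + 1)
    (hK : K.natDegree ≤ 3) (hQ : Q.natDegree ≤ 2) (hKQ : K ≠ 0 ∨ Q ≠ 0) (S : Finset F)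
    (hS : ∀ y ∈ S, ∃ x, x ^ q + x = E.eval y ∧ x * Q.eval y = K.eval y) :
    S.card ≤ 3 * q + 3 := by
  by_cases hQ0 : Q = 0
  · subst hQ0
    have hK0 : K ≠ 0 := hKQ.resolve_right (by simp)
    have := card_le_natDegree_of_forall_eval_eq_zero hK0 S fun y hy => by
      obtain ⟨x, -, h⟩ := hS y hy
      simpa using h.symm
    omega
  · have := card_le_natDegree_of_forall_eval_eq_zero (normEq_ne_zero hq (K := K) hE hQ0) S
      fun y hy => by
        obtain ⟨x, h1, h2⟩ := hS y hy
        simp only [Polynomial.eval_sub, Polynomial.eval_mul, Polynomial.eval_pow,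
          Polynomial.eval_add]
        rw [← h1, ← h2]
        ring
    refine this.trans ((Polynomial.natDegree_sub_le _ _).trans (max_le ?_ ?_))
    · refine Polynomial.natDegree_mul_le.trans ?_
      rw [Polynomial.natDegree_pow, hE]
      nlinarith
    · refine (Polynomial.natDegree_add_le _ _).trans (max_le ?_ ?_) <;>
      · refine Polynomial.natDegree_mul_le.trans ?_
        rw [Polynomial.natDegree_pow]
        nlinarith

end FiniteField

section SumBounds

variable {F : Type} [Fintype F] {q : ℕ}

theorem sum_lt_of_card_le (hq : 7 ≤ q) (hF : Fintype.card F = q ^ 2) (c : Option F → ℕ)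
    (S T : Finset (Option F)) (hTS : T ⊆ S) (hS : S.card ≤ q + 2) (hT : T.card ≤ q + 1)
    (h1 : ∀ P ∉ S, c P + q ≤ 2 * q ^ 3 + q ^ 2) (h2 : ∀ P ∉ T, P ∈ S → c P ≤ 4 * q ^ 3 + 3 * q ^ 2)
    (h3 : ∀ P ∈ T, c P ≤ q ^ 4) :
    ∑ P, c P + (q ^ 2 + 1) < 3 * (q ^ 5 + q ^ 2) + q ^ 3 + 1 := by
  classical
  zify at hq hS hT h1 h2 h3 ⊢
  have hle : ∀ P, (c P : ℤ) ≤ (2 * q ^ 3 + q ^ 2 - q) +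
      (if P ∈ S then (2 * q ^ 3 + 2 * q ^ 2 + q : ℤ) else 0) +
      (if P ∈ T then (q ^ 4 - 4 * q ^ 3 - 3 * q ^ 2 : ℤ) else 0) := by
    intro P
    by_cases hPT : P ∈ T
    · have := h3 P hPT
      rw [if_pos hPT, if_pos (hTS hPT)]
      linarith
    · by_cases hPS : P ∈ S
      · have := h2 P hPT hPS
        rw [if_neg hPT, if_pos hPS]
        linarith
      · have := h1 P hPS
        rw [if_neg hPT, if_neg hPS]
        linarith
  have hsum := Finset.sum_le_sum fun P (_ : P ∈ Finset.univ) => hle P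
  simp only [Finset.sum_add_distrib, Finset.sum_const, Finset.card_univ, Fintype.card_option, hF,
    nsmul_eq_mul, Finset.sum_ite_mem, Finset.univ_inter] at hsum
  push_cast at hsum
  have h4 : (S.card : ℤ) * (2 * q ^ 3 + 2 * q ^ 2 + q) ≤ (q + 2) * (2 * q ^ 3 + 2 * q ^ 2 + q) :=
    mul_le_mul_of_nonneg_right hS (by positivity)
  have h5 : (0 : ℤ) ≤ q ^ 4 - 4 * q ^ 3 - 3 * q ^ 2 := by
    have : (0 : ℤ) ≤ q ^ 2 * (q ^ 2 - 4 * q - 3) := mul_nonneg (by positivity) (by nlinarith)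
    linarith
  have h6 : (T.card : ℤ) * (q ^ 4 - 4 * q ^ 3 - 3 * q ^ 2) ≤
      (q + 1) * (q ^ 4 - 4 * q ^ 3 - 3 * q ^ 2) := mul_le_mul_of_nonneg_right hT h5
  have h7 : (q : ℤ) ^ 2 + q < q ^ 3 := by nlinarith
  nlinarith

theorem sum_lt_of_card_le_of_singular (hq : 7 ≤ q) (hF : Fintype.card F = q ^ 2) (c : Option F → ℕ)
    (T : Finset (Option F)) (hT : T.card ≤ 2 * q + 2)
    (h1 : ∀ P ∉ T, c P ≤ q ^ 3 + 2 * q ^ 2) (h2 : ∀ P ∈ T, c P ≤ (3 * q + 3) * q ^ 2) :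
    ∑ P, c P + (q ^ 2 + 1) < 3 * (q ^ 5 + q ^ 2) + q ^ 3 + 1 := by
  classical
  have hle : ∀ P, c P ≤ (q ^ 3 + 2 * q ^ 2) + (if P ∈ T then (3 * q + 3) * q ^ 2 else 0) := by
    intro P
    by_cases hPT : P ∈ T
    · have := h2 P hPT
      rw [if_pos hPT]
      omega
    · have := h1 P hPT
      rw [if_neg hPT]
      omega
  have hsum := Finset.sum_le_sum fun P (_ : P ∈ Finset.univ) => hle P
  simp only [Finset.sum_add_distrib, Finset.sum_const, Finset.card_univ, Fintype.card_option, hF,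
    smul_eq_mul, Finset.sum_ite_mem, Finset.univ_inter] at hsum
  have h4 : T.card * ((3 * q + 3) * q ^ 2) ≤ (2 * q + 2) * ((3 * q + 3) * q ^ 2) :=
    Nat.mul_le_mul_right _ hT
  have h5 : 8 * q ^ 4 + 12 * q ^ 3 + 6 * q ^ 2 < 2 * q ^ 5 := by
    have h6 : 8 * q ^ 2 + 12 * q + 6 < 2 * q ^ 3 := by
      have : 7 * q ^ 2 ≤ q * q ^ 2 := Nat.mul_le_mul_right _ hq
      nlinarith
    have := Nat.mul_lt_mul_of_pos_left h6 (show 0 < q ^ 2 by positivity)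
    nlinarith
  nlinarith

end SumBounds

section SlabCount

variable {F : Type} [Field F] [Fintype F] {q : ℕ}

open Classical in
/-- The number of triples `(y, x, z)` with `x ^ q + x = E y` and `f y x z = 0`. -/
noncomputable def slabCount (q : ℕ) (E : F → F) (f : F → F → F → F) : ℕ :=
  ∑ y, ∑ x with x ^ q + x = E y, Finset.card {z | f y x z = 0}

open Classical in
theorem slabCount_le (hq : 2 ≤ q) (hF : Fintype.card F = q ^ 2) {E : F → F} {f : F → F → F → F}
    (k : F → ℕ) (Y : Finset F)
    (hY : ∀ y x, x ^ q + x = E y → (∀ z, f y x z = 0) → y ∈ Y)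
    (huniq : ∀ y x x', x ^ q + x = E y → x' ^ q + x' = E y → (∀ z, f y x z = 0) →
      (∀ z, f y x' z = 0) → x = x')
    (hk : ∀ y x, ¬ (∀ z, f y x z = 0) → Finset.card {z | f y x z = 0} ≤ k y) :
    slabCount q E f ≤ ∑ y, q * k y + Y.card * q ^ 2 := by
  have hfull : ∀ y x, Finset.card {z | f y x z = 0} ≤ q ^ 2 := fun y x =>
    (Finset.card_le_univ _).trans hF.le
  have hrow : ∀ y, ∑ x with x ^ q + x = E y, Finset.card {z | f y x z = 0} ≤
      q * k y + if y ∈ Y then q ^ 2 else 0 := by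
    intro y
    have hcard := card_pow_add_self_le hq (E y) ({x | x ^ q + x = E y} : Finset F) (by simp)
    by_cases h : ∃ x, x ^ q + x = E y ∧ ∀ z, f y x z = 0
    · obtain ⟨x₀, hx₀, hz⟩ := h
      rw [if_pos (hY y x₀ hx₀ hz),
        ← Finset.sum_erase_add _ _ (show x₀ ∈ ({x | x ^ q + x = E y} : Finset F) by simpa)]
      refine add_le_add ((Finset.sum_le_card_nsmul _ _ (k y) ?_).trans ?_) (hfull y x₀)
      · intro x hx
        simp only [Finset.mem_erase, Finset.mem_filter, Finset.mem_univ, true_and] at hx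
        exact hk y x fun hz' => hx.1 (huniq y x x₀ hx.2 hx₀ hz' hz)
      · rw [smul_eq_mul]
        exact Nat.mul_le_mul_right _ ((Finset.card_le_card (Finset.erase_subset _ _)).trans hcard)
    · push Not at h
      refine le_add_right ((Finset.sum_le_card_nsmul _ _ (k y) ?_).trans ?_)
      · intro x hx
        simp only [Finset.mem_filter, Finset.mem_univ, true_and] at hx
        exact hk y x fun hz => (h x hx).elim fun z hz' => hz' (hz z)
      · rw [smul_eq_mul]
        exact Nat.mul_le_mul_right _ hcard
  refine (Finset.sum_le_sum fun y _ => hrow y).trans ?_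
  rw [Finset.sum_add_distrib, ← Finset.sum_filter, Finset.sum_const, smul_eq_mul]
  simp

open Classical in
theorem card_quadratic_zeros_le_two {a b c : F} (ha : a ≠ 0) :
    Finset.card {z : F | a * z ^ 2 + b * z + c = 0} ≤ 2 := by
  have h := card_le_natDegree_of_forall_eval_eq_zero
    (p := Polynomial.C a * Polynomial.X ^ 2 + Polynomial.C b * Polynomial.X + Polynomial.C c)
    (fun h => by simpa [h] using Polynomial.natDegree_quadratic (b := b) (c := c) ha)
    {z : F | a * z ^ 2 + b * z + c = 0} (by simp)
  rwa [Polynomial.natDegree_quadratic ha] at h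

open Classical in
theorem card_linear_zeros_le_one {b c : F} (hbc : ¬ ∀ z : F, b * z + c = 0) :
    Finset.card {z : F | b * z + c = 0} ≤ 1 := by
  refine Finset.card_le_one.2 fun x hx y hy => ?_
  simp only [Finset.mem_filter, Finset.mem_univ, true_and] at hx hy
  have h : b * (x - y) = 0 := by linear_combination hx - hy
  rcases mul_eq_zero.1 h with rfl | h
  · exact absurd (fun z => by simpa using hx) hbc
  · exact sub_eq_zero.1 h

/-- The data of the cubic on the pencil of planes through a generator with a fixed vertex. -/
structure SlabHyp (q : ℕ) (E : Polynomial F) (l₀ l₁ a₀ a₁ b₀ b₁ b₂ : F) (B : F → F → F)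
    (f : F → F → F → F) : Prop where
  natDegree_eq : E.natDegree = q + 1
  eval_eq : ∀ y x z, f y x z =
    (l₀ + l₁ * y) * z ^ 2 + (x * (a₀ + a₁ * y) + (b₀ + b₁ * y + b₂ * y ^ 2)) * z + B y x
  unique : ∀ y x x', x ^ q + x = E.eval y → x' ^ q + x' = E.eval y → (∀ z, f y x z = 0) →
      (∀ z, f y x' z = 0) → x = x'

variable {E : Polynomial F} {l₀ l₁ a₀ a₁ b₀ b₁ b₂ : F} {B : F → F → F} {f : F → F → F → F}

theorem SlabHyp.slabCount_le_of_linear_ne_zero (hq : 2 ≤ q) (hF : Fintype.card F = q ^ 2)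
    (h : SlabHyp q E l₀ l₁ a₀ a₁ b₀ b₁ b₂ B f) (hl : l₀ ≠ 0 ∨ l₁ ≠ 0) :
    slabCount q (fun y => E.eval y) f + q ≤ 2 * q ^ 3 + q ^ 2 := by
  classical
  let Y : Finset F := {y | l₀ + l₁ * y = 0}
  have hYcard : Y.card ≤ 1 := by
    have := card_linear_zeros_le_one (b := l₁) (c := l₀) (by
      intro h0
      have h1 := h0 0
      have h2 := h0 1
      simp only [mul_zero, zero_add, mul_one] at h1 h2
      simp_all)
    simpa only [add_comm, Y] using this
  have hcount := slabCount_le hq hF (E := fun y => E.eval y) (f := f)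
    (fun y => if y ∈ Y then 1 else 2) Y
    (by
      intro y x _ hz
      by_contra hy
      have hy' : l₀ + l₁ * y ≠ 0 := by simpa [Y] using hy
      have h2 := card_quadratic_zeros_le_two (b := x * (a₀ + a₁ * y) + (b₀ + b₁ * y + b₂ * y ^ 2))
        (c := B y x) hy'
      simp only [← h.eval_eq, hz, Finset.filter_true, Finset.card_univ, hF] at h2
      nlinarith)
    h.unique
    (by
      intro y x hz
      simp only [h.eval_eq] at hz ⊢
      split_ifs with hy
      · have hy' : l₀ + l₁ * y = 0 := by simpa [Y] using hy
        simp only [hy', zero_mul, zero_add] at hz ⊢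
        exact card_linear_zeros_le_one hz
      · exact card_quadratic_zeros_le_two (by simpa [Y] using hy))
  have hsum : ∑ y : F, q * (if y ∈ Y then 1 else 2) + q * Y.card = 2 * q ^ 3 := by
    have : ∀ y : F, q * (if y ∈ Y then 1 else 2) + q * (if y ∈ Y then 1 else 0) = 2 * q := by
      intro y
      split_ifs <;> ring
    have h2 := Finset.sum_congr (rfl : (Finset.univ : Finset F) = _) fun y _ => this y
    rw [Finset.sum_add_distrib, ← Finset.mul_sum (f := fun y => if y ∈ Y then 1 else 0)] at h2
    simp only [Finset.sum_boole, Finset.filter_univ_mem, Finset.sum_const, Finset.card_univ, hF,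
      smul_eq_mul, Nat.cast_id] at h2
    rw [h2]
    ring
  have : Y.card * q ≤ Y.card * q ^ 2 := Nat.mul_le_mul_left _ (by nlinarith)
  interval_cases hc : Y.card
  · nlinarith
  · omega

theorem SlabHyp.slabCount_le_of_linear_eq_zero (hq : 2 ≤ q) (hF : Fintype.card F = q ^ 2)
    (h : SlabHyp q E 0 0 a₀ a₁ b₀ b₁ b₂ B f) (Y : Finset F)
    (hY : ∀ y x, x ^ q + x = E.eval y →
      x * (a₀ + a₁ * y) + (b₀ + b₁ * y + b₂ * y ^ 2) = 0 → y ∈ Y) :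
    slabCount q (fun y => E.eval y) f ≤ q ^ 3 + Y.card * q ^ 2 := by
  classical
  have hcount := slabCount_le hq hF (E := fun y => E.eval y) (f := f) (fun _ => 1) Y
    (by
      intro y x hx hz
      refine hY y x hx ?_
      have h0 := hz 0
      have h1 := hz 1
      rw [h.eval_eq] at h0 h1
      linear_combination h1 - h0)
    h.unique
    (by
      intro y x hz
      simp only [h.eval_eq, zero_mul, zero_add] at hz ⊢
      exact card_linear_zeros_le_one hz)
  simp only [Finset.sum_const, Finset.card_univ, hF, smul_eq_mul] at hcount
  linarith [show q ^ 2 * (q * 1) = q ^ 3 by ring]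

theorem SlabHyp.slabCount_le_of_quadratic_ne_zero (hq : 2 ≤ q) (hF : Fintype.card F = q ^ 2)
    (h : SlabHyp q E 0 0 a₀ a₁ b₀ b₁ b₂ B f)
    (hne : ¬ (a₀ = 0 ∧ a₁ = 0 ∧ b₀ = 0 ∧ b₁ = 0 ∧ b₂ = 0)) :
    slabCount q (fun y => E.eval y) f ≤ 4 * q ^ 3 + 3 * q ^ 2 := by
  classical
  let K : Polynomial F := -(Polynomial.C b₂ * Polynomial.X ^ 2 + Polynomial.C b₁ * Polynomial.X +
    Polynomial.C b₀)
  let Q : Polynomial F := Polynomial.C a₁ * Polynomial.X + Polynomial.C a₀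
  let Y : Finset F := {y | ∃ x, x ^ q + x = E.eval y ∧ x * Q.eval y = K.eval y}
  have hYcard : Y.card ≤ 3 * q + 3 := by
    refine card_rational_inter_le hq (K := K) (Q := Q) h.natDegree_eq ?_ ?_ ?_ Y (by simp [Y])
    · rw [Polynomial.natDegree_neg]
      exact Polynomial.natDegree_quadratic_le.trans (by norm_num)
    · exact Polynomial.natDegree_linear_le.trans (by norm_num)
    · by_contra! hc
      apply hne
      have hK : ∀ n, K.coeff n = 0 := by simp [hc.1]
      have hQ : ∀ n, Q.coeff n = 0 := by simp [hc.2]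
      have h0 := hK 0
      have h1 := hK 1
      have h2 := hK 2
      have h3 := hQ 0
      have h4 := hQ 1
      simp [K, Q, Polynomial.coeff_X, Polynomial.coeff_C] at h0 h1 h2 h3 h4
      exact ⟨h3, h4, h0, h1, h2⟩
  have := h.slabCount_le_of_linear_eq_zero hq hF Y (by
    intro y x hx hxy
    simp only [Y, Q, K, Finset.mem_filter, Finset.mem_univ, true_and]
    refine ⟨x, hx, ?_⟩
    simp only [Polynomial.eval_add, Polynomial.eval_mul, Polynomial.eval_neg, Polynomial.eval_C,
      Polynomial.eval_X, Polynomial.eval_pow]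
    linear_combination hxy)
  have h2 : Y.card * q ^ 2 ≤ (3 * q + 3) * q ^ 2 := Nat.mul_le_mul_right _ hYcard
  nlinarith

theorem SlabHyp.slabCount_le_of_no_cross_term (hq : 2 ≤ q) (hF : Fintype.card F = q ^ 2)
    (h : SlabHyp q E 0 0 0 0 b₀ b₁ b₂ B f) (hne : ¬ (b₀ = 0 ∧ b₁ = 0 ∧ b₂ = 0)) :
    slabCount q (fun y => E.eval y) f ≤ q ^ 3 + 2 * q ^ 2 := by
  classical
  let K : Polynomial F := Polynomial.C b₂ * Polynomial.X ^ 2 + Polynomial.C b₁ * Polynomial.X +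
    Polynomial.C b₀
  let Y : Finset F := {y | K.eval y = 0}
  have hK0 : K ≠ 0 := by
    intro hc
    apply hne
    have hK : ∀ n, K.coeff n = 0 := by simp [hc]
    have h0 := hK 0
    have h1 := hK 1
    have h2 := hK 2
    simp [K, Polynomial.coeff_X, Polynomial.coeff_C] at h0 h1 h2
    exact ⟨h0, h1, h2⟩
  have hYcard : Y.card ≤ 2 :=
    (card_le_natDegree_of_forall_eval_eq_zero hK0 Y (by simp [Y])).trans
      Polynomial.natDegree_quadratic_le
  have := h.slabCount_le_of_linear_eq_zero hq hF Y (by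
    intro y x hx hxy
    simp only [Y, K, Finset.mem_filter, Finset.mem_univ, true_and]
    simp only [Polynomial.eval_add, Polynomial.eval_mul, Polynomial.eval_C,
      Polynomial.eval_X, Polynomial.eval_pow]
    linear_combination hxy)
  have h2 : Y.card * q ^ 2 ≤ 2 * q ^ 2 := Nat.mul_le_mul_right _ hYcard
  omega

theorem SlabHyp.slabCount_le_of_quadratic_eq_zero (hq : 2 ≤ q) (hF : Fintype.card F = q ^ 2)
    (h : SlabHyp q E 0 0 0 0 0 0 0 B f) (Y : Finset F)
    (hY : ∀ y x, x ^ q + x = E.eval y → B y x = 0 → y ∈ Y) :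
    slabCount q (fun y => E.eval y) f ≤ Y.card * q ^ 2 := by
  classical
  have heq : ∀ y x z, f y x z = B y x := fun y x z => by rw [h.eval_eq]; ring
  have hcount := slabCount_le hq hF (E := fun y => E.eval y) (f := f) (fun _ => 0) Y
    (fun y x hx hz => hY y x hx (by rw [← heq y x 0, hz]))
    h.unique
    (by
      intro y x hz
      simp only [heq, forall_const] at hz ⊢
      simp [hz])
  simpa using hcount

theorem SlabHyp.slabCount_le_pow_four (hq : 2 ≤ q) (hF : Fintype.card F = q ^ 2)
    (h : SlabHyp q E 0 0 0 0 0 0 0 B f) : slabCount q (fun y => E.eval y) f ≤ q ^ 4 := by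
  have := h.slabCount_le_of_quadratic_eq_zero hq hF Finset.univ (by simp)
  rw [Finset.card_univ, hF] at this
  linarith [show q ^ 2 * q ^ 2 = q ^ 4 by ring]

theorem SlabHyp.slabCount_le_of_cone (hq : 2 ≤ q) (hF : Fintype.card F = q ^ 2)
    (h : SlabHyp q E 0 0 0 0 0 0 0 B f) {K Q : Polynomial F} (hK : K.natDegree ≤ 3)
    (hQ : Q.natDegree ≤ 2) (hB : ∀ y x, B y x = x * Q.eval y - K.eval y)
    (hplane : ∃ y x z, f y x z ≠ 0) :
    slabCount q (fun y => E.eval y) f ≤ (3 * q + 3) * q ^ 2 := by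
  classical
  let Y : Finset F := {y | ∃ x, x ^ q + x = E.eval y ∧ x * Q.eval y = K.eval y}
  have hYcard : Y.card ≤ 3 * q + 3 := by
    refine card_rational_inter_le hq (K := K) (Q := Q) h.natDegree_eq hK hQ ?_ Y (by simp [Y])
    by_contra! hc
    obtain ⟨y, x, z, hf⟩ := hplane
    apply hf
    rw [h.eval_eq, hB, hc.1, hc.2]
    simp
  have := h.slabCount_le_of_quadratic_eq_zero hq hF Y (by
    intro y x hx hxy
    simp only [Y, Finset.mem_filter, Finset.mem_univ, true_and]
    refine ⟨x, hx, ?_⟩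
    rw [hB] at hxy
    linear_combination hxy)
  exact this.trans (Nat.mul_le_mul_right _ hYcard)

end SlabCount

section Pencil

variable {F : Type} [Field F]

/-- A nonzero binary form of degree `d` has at most `d` zeros on the projective line, the point
at infinity being `none`. -/
theorem card_zeros_option_le {p : Polynomial F} (hp : p ≠ 0) {d : ℕ} (hd : p.natDegree ≤ d)
    (S : Finset (Option F)) (hsome : ∀ t, some t ∈ S → p.eval t = 0)
    (hnone : none ∈ S → p.coeff d = 0) : S.card ≤ d := by
  classical
  have h := card_le_natDegree_of_forall_eval_eq_zero hp (Finset.eraseNone S)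
    fun t ht => hsome t (Finset.mem_eraseNone.1 ht)
  by_cases hS : none ∈ S
  · have h1 : p.natDegree ≠ d := by
      rintro rfl
      exact hp (Polynomial.leadingCoeff_eq_zero.1 (hnone hS))
    have h2 := Finset.card_eraseNone_of_mem hS
    have h3 := Finset.card_pos.2 ⟨_, hS⟩
    omega
  · rw [Finset.card_eraseNone_of_not_mem hS] at h
    omega

/-- A quadratic form in `(y₀, y₁, y₂)`. -/
def quadForm (r : Fin 6 → F) (y₀ y₁ y₂ : F) : F :=
  r 0 * y₀ ^ 2 + r 1 * y₀ * y₁ + r 2 * y₁ ^ 2 + r 3 * y₀ * y₂ + r 4 * y₁ * y₂ + r 5 * y₂ ^ 2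

/-- A linear form in `(y₀, y₁, y₂)`. -/
def linForm (a : Fin 3 → F) (y₀ y₁ y₂ : F) : F := a 0 * y₀ + a 1 * y₁ + a 2 * y₂

/-- A cubic form vanishing on the line `y₀ = y₁ = y₂ = 0`. -/
def cubicForm (a b d : Fin 3 → F) (r s : Fin 6 → F) (K : F → F → F → F) (x₀ x₁ y₀ y₁ y₂ : F) : F :=
  x₀ ^ 2 * linForm a y₀ y₁ y₂ + x₀ * x₁ * linForm b y₀ y₁ y₂ + x₁ ^ 2 * linForm d y₀ y₁ y₂ +
    x₀ * quadForm r y₀ y₁ y₂ + x₁ * quadForm s y₀ y₁ y₂ + K y₀ y₁ y₂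

/-- The cubic form restricted to the pencil of planes with a given vertex on the line. -/
def pencilForm (q : ℕ) (g : F → F → F → F → F → F) : Option F → F → F → F → F
  | none => fun y x z => g x z 1 0 y
  | some t => fun y x z => g z (z * t + x) (t ^ q) (-1) y

section Coefficients

variable (q : ℕ) (a b d : Fin 3 → F) (r s : Fin 6 → F) (K : F → F → F → F)

def coeffL₀ : Option F → F
  | none => d 0
  | some t => t ^ q * (a 0 + b 0 * t + d 0 * t ^ 2) - (a 1 + b 1 * t + d 1 * t ^ 2)

def coeffL₁ : Option F → F
  | none => d 2
  | some t => a 2 + b 2 * t + d 2 * t ^ 2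

def coeffA₀ : Option F → F
  | none => b 0
  | some t => t ^ q * (b 0 + 2 * d 0 * t) - (b 1 + 2 * d 1 * t)

def coeffA₁ : Option F → F
  | none => b 2
  | some t => b 2 + 2 * d 2 * t

def coeffB₀ : Option F → F
  | none => s 0
  | some t => (r 0 * t ^ (2 * q) - r 1 * t ^ q + r 2) + t * (s 0 * t ^ (2 * q) - s 1 * t ^ q + s 2)

def coeffB₁ : Option F → F
  | none => s 3
  | some t => (r 3 * t ^ q - r 4) + t * (s 3 * t ^ q - s 4)

def coeffB₂ : Option F → F
  | none => s 5
  | some t => r 5 + t * s 5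

def constTerm : Option F → F → F → F
  | none => fun y x => x ^ 2 * linForm a 1 0 y + x * quadForm r 1 0 y + K 1 0 y
  | some t => fun y x => x ^ 2 * linForm d (t ^ q) (-1) y + x * quadForm s (t ^ q) (-1) y +
      K (t ^ q) (-1) y

theorem pencilForm_cubicForm (P : Option F) (y x z : F) :
    pencilForm q (cubicForm a b d r s K) P y x z =
      (coeffL₀ q a b d P + coeffL₁ a b d P * y) * z ^ 2 +
        (x * (coeffA₀ q b d P + coeffA₁ b d P * y) +
          (coeffB₀ q r s P + coeffB₁ q r s P * y + coeffB₂ r s P * y ^ 2)) * z +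
        constTerm q a d r s K P y x := by
  cases P with
  | none =>
    simp only [pencilForm, cubicForm, coeffL₀, coeffL₁, coeffA₀, coeffA₁, coeffB₀, coeffB₁, coeffB₂,
      constTerm, linForm, quadForm]
    ring
  | some t =>
    simp only [pencilForm, cubicForm, coeffL₀, coeffL₁, coeffA₀, coeffA₁, coeffB₀, coeffB₁, coeffB₂,
      constTerm, linForm, quadForm]
    ring

variable {q a b d r s K}

theorem card_linear_zero_le (hq : 7 ≤ q) (h : ¬ (a = 0 ∧ b = 0 ∧ d = 0)) (S : Finset (Option F))
    (hS : ∀ P ∈ S, coeffL₀ q a b d P = 0 ∧ coeffL₁ a b d P = 0) : S.card ≤ q + 2 := by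
  let p : Polynomial F := Polynomial.C (d 0) * Polynomial.X ^ (q + 2) +
    Polynomial.C (b 0) * Polynomial.X ^ (q + 1) + Polynomial.C (a 0) * Polynomial.X ^ q -
    Polynomial.C (d 1) * Polynomial.X ^ 2 - Polynomial.C (b 1) * Polynomial.X - Polynomial.C (a 1)
  let p' : Polynomial F := Polynomial.C (d 2) * Polynomial.X ^ 2 +
    Polynomial.C (b 2) * Polynomial.X + Polynomial.C (a 2)
  obtain ⟨m, rfl⟩ := Nat.exists_eq_add_of_le' hq
  by_cases hp : p = 0
  · by_cases hp' : p' = 0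
    · refine absurd ?_ h
      have hc : ∀ n, p.coeff n = 0 := by simp [hp]
      have hc' : ∀ n, p'.coeff n = 0 := by simp [hp']
      have h0 := hc 0
      have h1 := hc 1
      have h2 := hc 2
      have h3 := hc (m + 7)
      have h4 := hc (m + 7 + 1)
      have h5 := hc (m + 7 + 2)
      have h6 := hc' 0
      have h7 := hc' 1
      have h8 := hc' 2
      simp [p, p', Polynomial.coeff_X, Polynomial.coeff_C, Polynomial.coeff_X_pow]
        at h0 h1 h2 h3 h4 h5 h6 h7 h8
      refine ⟨?_, ?_, ?_⟩ <;> ext i <;> fin_cases i <;> simpa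
    · refine (card_zeros_option_le hp' (d := 2) (by unfold p'; compute_degree) S ?_ ?_).trans
        (by omega)
      · intro t ht
        have := (hS _ ht).2
        simp only [coeffL₁] at this
        simp [p']
        linear_combination this
      · intro hn
        have := (hS _ hn).2
        simpa [p', coeffL₁, Polynomial.coeff_X, Polynomial.coeff_C] using this
  · refine card_zeros_option_le hp (by unfold p; compute_degree) S ?_ ?_
    · intro t ht
      have := (hS _ ht).1
      simp only [coeffL₀] at this
      simp [p]
      linear_combination this
    · intro hn
      have := (hS _ hn).1
      simpa [p, coeffL₀, Polynomial.coeff_X, Polynomial.coeff_C, Polynomial.coeff_X_pow] using this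

theorem card_quadratic_zero_le (hq : 7 ≤ q) (h2 : (2 : F) = 0 → Even q)
    (h : ¬ (a = 0 ∧ b = 0 ∧ d = 0)) (S : Finset (Option F))
    (hS : ∀ P ∈ S, coeffL₀ q a b d P = 0 ∧ coeffL₁ a b d P = 0 ∧ coeffA₀ q b d P = 0 ∧
      coeffA₁ b d P = 0) : S.card ≤ q + 1 := by
  classical
  by_cases hb : b = 0 ∧ 2 * d 0 = 0 ∧ 2 * d 1 = 0 ∧ 2 * d 2 = 0
  · obtain ⟨rfl, hd0, hd1, hd2⟩ := hb
    by_cases hlast : a 2 = 0 ∧ d 2 = 0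
    · by_cases htwo : (2 : F) = 0
      · obtain ⟨m, hm⟩ := h2 htwo
        obtain ⟨k, rfl⟩ := Nat.exists_eq_add_of_le' (show 3 ≤ m by omega)
        let p : Polynomial F := Polynomial.C (d 0) * Polynomial.X ^ (k + 3 + 1) +
          Polynomial.C (a 0) * Polynomial.X ^ (k + 3) - Polynomial.C (d 1) * Polynomial.X -
          Polynomial.C (a 1)
        have hp : p ≠ 0 := by
          intro hp
          refine h ?_
          have hc : ∀ n, p.coeff n = 0 := by simp [hp]
          have h0 := hc 0
          have h1 := hc 1
          have h2 := hc (k + 3)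
          have h3 := hc (k + 3 + 1)
          simp [p, Polynomial.coeff_X, Polynomial.coeff_C, Polynomial.coeff_X_pow] at h0 h1 h2 h3
          refine ⟨?_, rfl, ?_⟩ <;> ext i <;> fin_cases i <;> simp_all
        have hinj : Function.Injective (Option.map fun t : F => t ^ 2) := by
          refine Option.map_injective fun x y hxy => sub_eq_zero.1 (pow_eq_zero_iff two_ne_zero |>.1
            (?_ : (x - y) ^ 2 = 0))
          have hxy : x ^ 2 = y ^ 2 := hxy
          linear_combination hxy + (y ^ 2 - x * y) * htwo
        rw [← Finset.card_image_of_injective S hinj]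
        refine (card_zeros_option_le hp (d := k + 3 + 1) (by unfold p; compute_degree) _
          ?_ ?_).trans (by omega)
        · intro u hu
          obtain ⟨P, hP, hPu⟩ := Finset.mem_image.1 hu
          cases P with
          | none => simp at hPu
          | some t =>
            simp only [Option.map_some, Option.some.injEq] at hPu
            subst hPu
            have := (hS _ hP).1
            simp only [coeffL₀, Pi.zero_apply] at this
            simp only [p, Polynomial.eval_sub, Polynomial.eval_add, Polynomial.eval_mul,
              Polynomial.eval_pow, Polynomial.eval_C, Polynomial.eval_X]
            rw [hm] at this
            linear_combination this
        · intro hu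
          obtain ⟨P, hP, hPu⟩ := Finset.mem_image.1 hu
          cases P with
          | none =>
            have := (hS _ hP).1
            simpa [p, coeffL₀, Polynomial.coeff_X, Polynomial.coeff_C, Polynomial.coeff_X_pow]
              using this
          | some t => simp at hPu
      · have hd : d = 0 := by
          ext i
          fin_cases i <;> simp_all
        subst hd
        let p : Polynomial F := Polynomial.C (a 0) * Polynomial.X ^ q - Polynomial.C (a 1)
        have hp : p ≠ 0 := by
          intro hp
          refine h ⟨?_, rfl, rfl⟩
          have hc : ∀ n, p.coeff n = 0 := by simp [hp]
          have h0 := hc 0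
          have h1 := hc q
          have hq0 : q ≠ 0 := by omega
          simp [p, Polynomial.coeff_C, Polynomial.coeff_X_pow, hq0, hq0.symm] at h0 h1
          ext i
          fin_cases i <;> simp_all
        refine card_zeros_option_le hp ((by unfold p; compute_degree : p.natDegree ≤ q).trans
          (by omega)) S ?_ ?_
        · intro t ht
          have := (hS _ ht).1
          simp only [coeffL₀, Pi.zero_apply] at this
          simp [p]
          linear_combination this
        · intro _
          simp [p, Polynomial.coeff_X_pow]
    · let p : Polynomial F := Polynomial.C (d 2) * Polynomial.X ^ 2 + Polynomial.C (a 2)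
      have hp : p ≠ 0 := by
        intro hp
        apply hlast
        have hc : ∀ n, p.coeff n = 0 := by simp [hp]
        have h0 := hc 0
        have h1 := hc 2
        simp [p, Polynomial.coeff_C] at h0 h1
        exact ⟨h0, h1⟩
      refine (card_zeros_option_le hp (d := 2) (by unfold p; compute_degree) S ?_ ?_).trans
        (by omega)
      · intro t ht
        have := (hS _ ht).2.1
        simp only [coeffL₁, Pi.zero_apply] at this
        simp [p]
        linear_combination this
      · intro hn
        have := (hS _ hn).2.1
        simpa [p, coeffL₁, Polynomial.coeff_C] using this
  · let p : Polynomial F := Polynomial.C (2 * d 0) * Polynomial.X ^ (q + 1) +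
      Polynomial.C (b 0) * Polynomial.X ^ q - Polynomial.C (2 * d 1) * Polynomial.X -
      Polynomial.C (b 1)
    let p' : Polynomial F := Polynomial.C (2 * d 2) * Polynomial.X + Polynomial.C (b 2)
    obtain ⟨m, rfl⟩ := Nat.exists_eq_add_of_le' hq
    by_cases hp : p = 0
    · have hp' : p' ≠ 0 := by
        intro hp'
        refine hb ?_
        have hc : ∀ n, p.coeff n = 0 := by simp [hp]
        have hc' : ∀ n, p'.coeff n = 0 := by simp [hp']
        have h0 := hc 0
        have h1 := hc 1
        have h2 := hc (m + 7)
        have h3 := hc (m + 7 + 1)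
        have h4 := hc' 0
        have h5 := hc' 1
        simp only [p, p', Polynomial.coeff_add, Polynomial.coeff_sub, Polynomial.coeff_C_mul,
          Polynomial.coeff_X, Polynomial.coeff_C, Polynomial.coeff_X_pow] at h0 h1 h2 h3 h4 h5
        norm_num at h0 h1 h2 h3 h4 h5
        refine ⟨?_, by simpa using h3, by simpa using h1, by simpa using h5⟩
        ext i
        fin_cases i <;> simpa
      refine (card_zeros_option_le hp' (d := 1) (by unfold p'; compute_degree) S ?_ ?_).trans
        (by omega)
      · intro t ht
        have := (hS _ ht).2.2.2
        simp only [coeffA₁] at this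
        simp [p']
        linear_combination this
      · intro hn
        have := (hS _ hn).2.1
        simp only [coeffL₁] at this
        simp [p', this]
    · refine card_zeros_option_le hp (by unfold p; compute_degree) S ?_ ?_
      · intro t ht
        have := (hS _ ht).2.2.1
        simp only [coeffA₀] at this
        simp [p]
        linear_combination this
      · intro hn
        have := (hS _ hn).1
        simp only [coeffL₀] at this
        simp [p, this, Polynomial.coeff_X_pow]

theorem card_quadratic_zero_le_of_singular (hq : 7 ≤ q) (h : ¬ (r = 0 ∧ s = 0))
    (S : Finset (Option F))
    (hS : ∀ P ∈ S, coeffB₀ q r s P = 0 ∧ coeffB₁ q r s P = 0 ∧ coeffB₂ r s P = 0) :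
    S.card ≤ 2 * q + 2 := by
  let p₀ : Polynomial F := Polynomial.C (s 0) * Polynomial.X ^ (2 * q + 1) +
    Polynomial.C (r 0) * Polynomial.X ^ (2 * q) - Polynomial.C (s 1) * Polynomial.X ^ (q + 1) -
    Polynomial.C (r 1) * Polynomial.X ^ q + Polynomial.C (s 2) * Polynomial.X + Polynomial.C (r 2)
  let p₁ : Polynomial F := Polynomial.C (s 3) * Polynomial.X ^ (q + 1) +
    Polynomial.C (r 3) * Polynomial.X ^ q - Polynomial.C (s 4) * Polynomial.X - Polynomial.C (r 4)
  let p₂ : Polynomial F := Polynomial.C (s 5) * Polynomial.X + Polynomial.C (r 5)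
  have key : ∀ p : Polynomial F, p ≠ 0 → p.natDegree ≤ 2 * q + 1 →
      (∀ t, some t ∈ S → p.eval t = 0) → S.card ≤ 2 * q + 2 := fun p hp hd hs =>
    card_zeros_option_le hp (by omega) S hs fun _ =>
      Polynomial.coeff_eq_zero_of_natDegree_lt (by omega)
  by_cases hp₀ : p₀ = 0
  · by_cases hp₁ : p₁ = 0
    · by_cases hp₂ : p₂ = 0
      · refine absurd ?_ h
        obtain ⟨m, rfl⟩ := Nat.exists_eq_add_of_le' hq
        have hc₀ : ∀ n, p₀.coeff n = 0 := by simp [hp₀]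
        have hc₁ : ∀ n, p₁.coeff n = 0 := by simp [hp₁]
        have hc₂ : ∀ n, p₂.coeff n = 0 := by simp [hp₂]
        have e1 : m + 7 ≠ 2 * (m + 7) := by omega
        have e2 : m + 7 + 1 ≠ 2 * (m + 7) := by omega
        have e3 : 2 * (m + 7) ≠ m + 6 := by omega
        have e4 : 1 ≠ 2 * (m + 7) := by omega
        have h0 := hc₀ 0
        have h1 := hc₀ 1
        have h2 := hc₀ (m + 7)
        have h3 := hc₀ (m + 7 + 1)
        have h4 := hc₀ (2 * (m + 7))
        have h5 := hc₀ (2 * (m + 7) + 1)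
        have k0 := hc₁ 0
        have k1 := hc₁ 1
        have k2 := hc₁ (m + 7)
        have k3 := hc₁ (m + 7 + 1)
        have j0 := hc₂ 0
        have j1 := hc₂ 1
        simp [p₀, p₁, p₂, Polynomial.coeff_X, Polynomial.coeff_C, Polynomial.coeff_X_pow, e1, e2,
          e1.symm, e2.symm, e3, e3.symm, e4]
          at h0 h1 h2 h3 h4 h5 k0 k1 k2 k3 j0 j1
        refine ⟨?_, ?_⟩ <;> ext i <;> fin_cases i <;> simpa
      · refine key p₂ hp₂ ((by unfold p₂; compute_degree : p₂.natDegree ≤ 1).trans (by omega)) ?_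
        intro t ht
        have := (hS _ ht).2.2
        simp only [coeffB₂] at this
        simp [p₂]
        linear_combination this
    · refine key p₁ hp₁ ((by unfold p₁; compute_degree : p₁.natDegree ≤ q + 1).trans (by omega)) ?_
      intro t ht
      have := (hS _ ht).2.1
      simp only [coeffB₁] at this
      simp [p₁]
      linear_combination this
  · refine key p₀ hp₀ (by unfold p₀; compute_degree; all_goals omega) ?_
    intro t ht
    have := (hS _ ht).1
    simp only [coeffB₀] at this
    simp [p₀]
    linear_combination this

theorem exists_constTerm_eq (P : Option F)
    (hK : ∀ y₀ y₁, ∃ k : Polynomial F, k.natDegree ≤ 3 ∧ ∀ y, K y₀ y₁ y = k.eval y) :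
    ∃ k l : Polynomial F, k.natDegree ≤ 3 ∧ l.natDegree ≤ 2 ∧
      ∀ y x, constTerm q 0 0 r s K P y x = x * l.eval y - k.eval y := by
  have hquad : ∀ (c : Fin 6 → F) (y₀ y₁ : F), ∃ l : Polynomial F, l.natDegree ≤ 2 ∧
      ∀ y, quadForm c y₀ y₁ y = l.eval y := fun c y₀ y₁ =>
    ⟨Polynomial.C (c 5) * Polynomial.X ^ 2 + Polynomial.C (c 3 * y₀ + c 4 * y₁) * Polynomial.X +
      Polynomial.C (c 0 * y₀ ^ 2 + c 1 * y₀ * y₁ + c 2 * y₁ ^ 2),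
      Polynomial.natDegree_quadratic_le, fun y => by simp [quadForm]; ring⟩
  cases P with
  | none =>
    obtain ⟨k, hk, hk'⟩ := hK 1 0
    obtain ⟨l, hl, hl'⟩ := hquad r 1 0
    exact ⟨-k, l, by simpa, hl, fun y x => by simp [constTerm, linForm, hk', hl']⟩
  | some t =>
    obtain ⟨k, hk, hk'⟩ := hK (t ^ q) (-1)
    obtain ⟨l, hl, hl'⟩ := hquad s (t ^ q) (-1)
    exact ⟨-k, l, by simpa, hl, fun y x => by simp [constTerm, linForm, hk', hl']⟩

variable [Fintype F]

theorem sum_slabCount_lt (hq : 7 ≤ q) (hF : Fintype.card F = q ^ 2) (htwo : (2 : F) = 0 → Even q)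
    (E : Option F → Polynomial F) (hE : ∀ P, (E P).natDegree = q + 1)
    (hK : ∀ y₀ y₁, ∃ k : Polynomial F, k.natDegree ≤ 3 ∧ ∀ y, K y₀ y₁ y = k.eval y)
    (huniq : ∀ P y x x', x ^ q + x = (E P).eval y → x' ^ q + x' = (E P).eval y →
      (∀ z, pencilForm q (cubicForm a b d r s K) P y x z = 0) →
      (∀ z, pencilForm q (cubicForm a b d r s K) P y x' z = 0) → x = x')
    (hplane : ∀ P y, ∃ x z, pencilForm q (cubicForm a b d r s K) P y x z ≠ 0) :
    ∑ P, slabCount q (fun y => (E P).eval y) (pencilForm q (cubicForm a b d r s K) P) +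
      (q ^ 2 + 1) < 3 * (q ^ 5 + q ^ 2) + q ^ 3 + 1 := by
  classical
  have hslab : ∀ P, SlabHyp q (E P) (coeffL₀ q a b d P) (coeffL₁ a b d P) (coeffA₀ q b d P)
      (coeffA₁ b d P) (coeffB₀ q r s P) (coeffB₁ q r s P) (coeffB₂ r s P)
      (constTerm q a d r s K P) (pencilForm q (cubicForm a b d r s K) P) := fun P =>
    ⟨hE P, pencilForm_cubicForm q a b d r s K P, huniq P⟩
  have hq2 : 2 ≤ q := by omega
  by_cases habd : a = 0 ∧ b = 0 ∧ d = 0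
  · obtain ⟨rfl, rfl, rfl⟩ := habd
    have hslab' : ∀ P, SlabHyp q (E P) 0 0 0 0 (coeffB₀ q r s P) (coeffB₁ q r s P)
        (coeffB₂ r s P) (constTerm q 0 0 r s K P) (pencilForm q (cubicForm 0 0 0 r s K) P) := by
      intro P
      have := hslab P
      cases P <;> simpa [coeffL₀, coeffL₁, coeffA₀, coeffA₁] using this
    by_cases hrs : r = 0 ∧ s = 0
    · obtain ⟨rfl, rfl⟩ := hrs
      refine sum_lt_of_card_le_of_singular hq hF _ ∅ (by simp) (fun P _ => ?_) (by simp)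
      have h : SlabHyp q (E P) 0 0 0 0 0 0 0 (constTerm q 0 0 0 0 K P)
          (pencilForm q (cubicForm 0 0 0 0 0 K) P) := by
        have := hslab' P
        cases P <;> simpa [coeffB₀, coeffB₁, coeffB₂] using this
      refine (h.slabCount_le_of_quadratic_eq_zero hq2 hF ∅ ?_).trans (by simp)
      intro y x _ hB
      obtain ⟨x', z, hf⟩ := hplane P y
      refine absurd ?_ hf
      rw [h.eval_eq]
      have hxx : constTerm q 0 0 0 0 K P y x' = constTerm q 0 0 0 0 K P y x := by
        cases P <;> simp [constTerm, linForm, quadForm]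
      rw [hxx, hB]
      ring
    · let T : Finset (Option F) := {P | coeffB₀ q r s P = 0 ∧ coeffB₁ q r s P = 0 ∧
        coeffB₂ r s P = 0}
      refine sum_lt_of_card_le_of_singular hq hF _ T
        (card_quadratic_zero_le_of_singular hq hrs T (by simp [T])) ?_ ?_
      · intro P hP
        exact (hslab' P).slabCount_le_of_no_cross_term hq2 hF (by simpa [T] using hP)
      · intro P hP
        have hP' : coeffB₀ q r s P = 0 ∧ coeffB₁ q r s P = 0 ∧ coeffB₂ r s P = 0 := by
          simpa [T] using hP
        have h := hslab' P
        rw [hP'.1, hP'.2.1, hP'.2.2] at h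
        obtain ⟨k, l, hk, hl, hkl⟩ := exists_constTerm_eq (q := q) (r := r) (s := s) P hK
        exact h.slabCount_le_of_cone hq2 hF hk hl hkl ⟨0, hplane P 0⟩
  · let S : Finset (Option F) := {P | coeffL₀ q a b d P = 0 ∧ coeffL₁ a b d P = 0}
    let T : Finset (Option F) := {P | (coeffL₀ q a b d P = 0 ∧ coeffL₁ a b d P = 0) ∧
      coeffA₀ q b d P = 0 ∧ coeffA₁ b d P = 0 ∧ coeffB₀ q r s P = 0 ∧ coeffB₁ q r s P = 0 ∧
        coeffB₂ r s P = 0}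
    refine sum_lt_of_card_le hq hF _ S T ?_ (card_linear_zero_le hq habd S (by simp [S]))
      (card_quadratic_zero_le hq htwo habd T ?_) ?_ ?_ ?_
    · intro P hP
      simp only [S, T, Finset.mem_filter, Finset.mem_univ, true_and] at hP ⊢
      exact hP.1
    · intro P hP
      simp only [T, Finset.mem_filter, Finset.mem_univ, true_and] at hP
      exact ⟨hP.1.1, hP.1.2, hP.2.1, hP.2.2.1⟩
    · intro P hP
      refine (hslab P).slabCount_le_of_linear_ne_zero hq2 hF ?_
      simp only [S, Finset.mem_filter, Finset.mem_univ, true_and] at hP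
      tauto
    · intro P hPT hPS
      simp only [S, T, Finset.mem_filter, Finset.mem_univ, true_and] at hPT hPS
      have h := hslab P
      rw [hPS.1, hPS.2] at h
      exact h.slabCount_le_of_quadratic_ne_zero hq2 hF (by tauto)
    · intro P hP
      simp only [T, Finset.mem_filter, Finset.mem_univ, true_and] at hP
      obtain ⟨⟨e1, e2⟩, e3, e4, e5, e6, e7⟩ := hP
      have h := hslab P
      rw [e1, e2, e3, e4, e5, e6, e7] at h
      exact h.slabCount_le_pow_four hq2 hF

end Coefficients

end Pencil

section CubicExpansion

variable {F : Type} [Field F]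

theorem exists_forall_eval_eq_sum {G : MvPolynomial (Fin 5) F} (hG : G.IsHomogeneous 3) :
    ∃ c : Fin 5 → Fin 5 → Fin 5 → F, ∀ x : Fin 5 → F,
      eval x G = ∑ i, ∑ j, ∑ k, c i j k * (x i * x j * x k) := by
  classical
  have hmono : ∀ m ∈ G.support, ∃ c : Fin 5 → Fin 5 → Fin 5 → F, ∀ x : Fin 5 → F,
      G.coeff m * ∏ i, x i ^ m i = ∑ i, ∑ j, ∑ k, c i j k * (x i * x j * x k) := by
    intro m hm
    have hdeg : m.degree = 3 := by
      rw [Finsupp.degree_eq_weight_one (R := ℕ)]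
      exact hG (MvPolynomial.mem_support_iff.1 hm)
    have hcard : Multiset.card (Finsupp.toMultiset m) = 3 := by
      rw [Finsupp.card_toMultiset, ← hdeg, Finsupp.degree]
      rfl
    obtain ⟨i₀, j₀, k₀, hijk⟩ := Multiset.card_eq_three.1 hcard
    refine ⟨fun i j k => if i = i₀ then (if j = j₀ then (if k = k₀ then G.coeff m else 0) else 0)
      else 0, fun x => ?_⟩
    have hprod : ∏ i, x i ^ m i = x i₀ * x j₀ * x k₀ := by
      have h1 := Finsupp.prod_toMultiset (m.mapDomain x)
      rw [← Finsupp.toMultiset_map, hijk, Finsupp.prod_mapDomain_index (by simp)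
        (by intros; rw [pow_add])] at h1
      rw [Finsupp.prod_fintype _ _ (by simp)] at h1
      rw [← h1]
      simp [mul_assoc]
    rw [hprod]
    simp [ite_mul]
  choose! c hc using hmono
  refine ⟨fun i j k => ∑ m ∈ G.support, c m i j k, fun x => ?_⟩
  rw [MvPolynomial.eval_eq', Finset.sum_congr rfl fun m hm => hc m hm x, Finset.sum_comm]
  refine Finset.sum_congr rfl fun i _ => ?_
  rw [Finset.sum_comm]
  refine Finset.sum_congr rfl fun j _ => ?_
  rw [Finset.sum_comm]
  refine Finset.sum_congr rfl fun k _ => ?_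
  rw [Finset.sum_mul]

theorem exists_forall_eval_combination_eq_sum {G : MvPolynomial (Fin 5) F} (hG : G.IsHomogeneous 3)
    (v : Fin 5 → Fin 5 → F) :
    ∃ c : Fin 5 → Fin 5 → Fin 5 → F, ∀ u : Fin 5 → F,
      eval (∑ m, u m • v m) G = ∑ i, ∑ j, ∑ k, c i j k * (u i * u j * u k) := by
  let φ : Fin 5 → MvPolynomial (Fin 5) F := fun i => ∑ m, C (v m i) * X m
  have hφ : (aeval φ G).IsHomogeneous 3 := by
    have := hG.aeval φ (n := 1) fun i => IsHomogeneous.sum _ _ _ fun m _ => by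
      simpa using (isHomogeneous_C (Fin 5) (v m i)).mul (isHomogeneous_X F m)
    simpa using this
  obtain ⟨c, hc⟩ := exists_forall_eval_eq_sum hφ
  refine ⟨c, fun u => ?_⟩
  rw [← hc]
  change _ = aeval u (aeval φ G)
  rw [← AlgHom.comp_apply, MvPolynomial.comp_aeval, MvPolynomial.aeval_eq_eval]
  congr 1
  congr 1
  ext i
  simp [φ, mul_comm]

theorem exists_cubicForm_eq (c : Fin 5 → Fin 5 → Fin 5 → F)
    (hc : ∀ x₀ x₁ : F, ∑ i, ∑ j, ∑ k, c i j k *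
      ((![x₀, x₁, 0, 0, 0] : Fin 5 → F) i * (![x₀, x₁, 0, 0, 0] : Fin 5 → F) j *
        (![x₀, x₁, 0, 0, 0] : Fin 5 → F) k) = 0) :
    ∃ (a b d : Fin 3 → F) (r s : Fin 6 → F) (K : F → F → F → F),
      (∀ y₀ y₁, ∃ k : Polynomial F, k.natDegree ≤ 3 ∧ ∀ y, K y₀ y₁ y = k.eval y) ∧
      ∀ x₀ x₁ y₀ y₁ y₂ : F, ∑ i, ∑ j, ∑ k, c i j k *
        ((![x₀, x₁, y₀, y₁, y₂] : Fin 5 → F) i * (![x₀, x₁, y₀, y₁, y₂] : Fin 5 → F) j *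
        (![x₀, x₁, y₀, y₁, y₂] : Fin 5 → F) k) = cubicForm a b d r s K x₀ x₁ y₀ y₁ y₂ := by
  let A : Fin 5 → Fin 5 → F := fun i n => c i i n + c i n i + c n i i
  let B : Fin 5 → Fin 5 → Fin 5 → F := fun i m n =>
    c i m n + c i n m + c m i n + c n i m + c m n i + c n m i
  refine ⟨![A 0 2, A 0 3, A 0 4], ![B 0 1 2, B 0 1 3, B 0 1 4], ![A 1 2, A 1 3, A 1 4],
    ![A 2 0, B 0 2 3, A 3 0, B 0 2 4, B 0 3 4, A 4 0],
    ![A 2 1, B 1 2 3, A 3 1, B 1 2 4, B 1 3 4, A 4 1],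
    fun y₀ y₁ y₂ => (c 2 2 2 * y₀ ^ 3 + A 2 3 * y₀ ^ 2 * y₁ + A 3 2 * y₀ * y₁ ^ 2 +
      c 3 3 3 * y₁ ^ 3) + (A 2 4 * y₀ ^ 2 + B 2 3 4 * y₀ * y₁ + A 3 4 * y₁ ^ 2) * y₂ +
      (A 4 2 * y₀ + A 4 3 * y₁) * y₂ ^ 2 + c 4 4 4 * y₂ ^ 3, ?_, ?_⟩
  · intro y₀ y₁
    refine ⟨Polynomial.C (c 4 4 4) * Polynomial.X ^ 3 +
      Polynomial.C (A 4 2 * y₀ + A 4 3 * y₁) * Polynomial.X ^ 2 +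
      Polynomial.C (A 2 4 * y₀ ^ 2 + B 2 3 4 * y₀ * y₁ + A 3 4 * y₁ ^ 2) * Polynomial.X +
      Polynomial.C (c 2 2 2 * y₀ ^ 3 + A 2 3 * y₀ ^ 2 * y₁ + A 3 2 * y₀ * y₁ ^ 2 +
      c 3 3 3 * y₁ ^ 3), Polynomial.natDegree_cubic_le, fun y => ?_⟩
    simp only [Polynomial.eval_add, Polynomial.eval_mul, Polynomial.eval_pow, Polynomial.eval_C,
      Polynomial.eval_X]
    ring
  · intro x₀ x₁ y₀ y₁ y₂
    have h := hc x₀ x₁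
    simp [Fin.sum_univ_five] at h
    simp [Fin.sum_univ_five, cubicForm, linForm, quadForm, A, B]
    linear_combination h

end CubicExpansion

section HermitianForm

variable {F : Type} [Field F] {q : ℕ}

/-- The sesquilinear form whose associated Hermitian variety in `ℙ⁴` is `hermV3`. -/
def hform (q : ℕ) (u v : Fin 5 → F) : F := ∑ i, u i * v i ^ q

theorem hform_self (u : Fin 5 → F) : hform q u u = ∑ i, u i ^ (q + 1) :=
  Finset.sum_congr rfl fun i _ => (pow_succ' (u i) q).symm

theorem hform_add_left (u u' v : Fin 5 → F) : hform q (u + u') v = hform q u v + hform q u' v := by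
  simp [hform, add_mul, Finset.sum_add_distrib]

theorem hform_smul_left (a : F) (u v : Fin 5 → F) : hform q (a • u) v = a * hform q u v := by
  simp [hform, Finset.mul_sum, mul_assoc]

theorem hform_smul_right (a : F) (u v : Fin 5 → F) :
    hform q u (a • v) = a ^ q * hform q u v := by
  simp only [hform, Finset.mul_sum, Pi.smul_apply, smul_eq_mul, mul_pow]
  exact Finset.sum_congr rfl fun i _ => by ring

theorem hform_add_right (hadd : ∀ x y : F, (x + y) ^ q = x ^ q + y ^ q) (u v v' : Fin 5 → F) :
    hform q u (v + v') = hform q u v + hform q u v' := by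
  simp [hform, hadd, mul_add, Finset.sum_add_distrib]

theorem hform_single_left (i : Fin 5) (a : F) (v : Fin 5 → F) :
    hform q (Pi.single i a) v = a * v i ^ q := by
  simp [hform, Pi.single_apply]

theorem hform_sub_left (u u' v : Fin 5 → F) : hform q (u - u') v = hform q u v - hform q u' v := by
  simp [hform, sub_mul, Finset.sum_sub_distrib]

theorem hform_swap (hq : q ≠ 0) (hadd : ∀ x y : F, (x + y) ^ q = x ^ q + y ^ q)
    (hqq : ∀ x : F, (x ^ q) ^ q = x) (u v : Fin 5 → F) : hform q u v ^ q = hform q v u := by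
  have hsum : ∀ f : Fin 5 → F, (∑ i, f i) ^ q = ∑ i, f i ^ q := fun f =>
    map_sum (⟨⟨fun x => x ^ q, zero_pow hq⟩, hadd⟩ : F →+ F) f Finset.univ
  simp only [hform, hsum, mul_pow, hqq]
  exact Finset.sum_congr rfl fun i _ => mul_comm _ _

theorem hform_eq_zero_of_forall_isotropic [Fintype F] (hq : 2 ≤ q) (hF : Fintype.card F = q ^ 2)
    (hadd : ∀ x y : F, (x + y) ^ q = x ^ q + y ^ q) (hqq : ∀ x : F, (x ^ q) ^ q = x)
    {e₀ e₁ : Fin 5 → F}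
    (h : ∀ s t : F, hform q (s • e₀ + t • e₁) (s • e₀ + t • e₁) = 0) :
    hform q e₀ e₀ = 0 ∧ hform q e₁ e₁ = 0 ∧ hform q e₀ e₁ = 0 ∧ hform q e₁ e₀ = 0 := by
  have h0 : hform q e₀ e₀ = 0 := by simpa using h 1 0
  have h1 : hform q e₁ e₁ = 0 := by simpa using h 0 1
  have hq0 : q ≠ 0 := by omega
  have key : hform q e₀ e₁ = 0 := by
    by_contra hne
    have hall : ∀ u : F, u ^ q + u = 0 := by
      intro u
      have := h (u / hform q e₀ e₁) 1
      simp only [hform_add_left, hform_smul_left, hform_add_right hadd, hform_smul_right, h0, h1,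
        ← hform_swap hq0 hadd hqq e₀ e₁, one_pow, div_pow] at this
      have hne' := pow_ne_zero q hne
      field_simp at this
      refine mul_left_cancel₀ (mul_ne_zero hne' hne) ?_
      linear_combination this
    have := card_pow_add_self_le hq (0 : F) Finset.univ fun u _ => hall u
    rw [Finset.card_univ, hF] at this
    nlinarith
  exact ⟨h0, h1, key, by rw [← hform_swap hq0 hadd hqq, key, zero_pow hq0]⟩

theorem exists_dual_pair (hadd : ∀ x y : F, (x + y) ^ q = x ^ q + y ^ q)
    {e₀ e₁ : Fin 5 → F} (he : LinearIndependent F ![e₀, e₁]) :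
    ∃ f₀ f₁ : Fin 5 → F, hform q f₀ e₀ = 1 ∧ hform q f₀ e₁ = 0 ∧ hform q f₁ e₀ = 0 ∧
      hform q f₁ e₁ = 1 := by
  obtain ⟨i, j, hij⟩ : ∃ i j, e₀ i * e₁ j - e₀ j * e₁ i ≠ 0 := by
    by_contra! hc
    have h0 : ∀ i, e₀ i = 0 := by
      intro i
      have h := LinearIndependent.pair_iff.1 he (-e₁ i) (e₀ i) (by
        ext j
        simp only [Pi.add_apply, Pi.smul_apply, smul_eq_mul, Pi.zero_apply]
        linear_combination hc i j)
      exact h.2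
    have := LinearIndependent.pair_iff.1 he 1 0 (by ext i; simp [h0])
    exact one_ne_zero this.1
  have hD : (e₀ i) ^ q * (e₁ j) ^ q - (e₀ j) ^ q * (e₁ i) ^ q ≠ 0 := by
    intro h
    apply pow_ne_zero q hij
    have h1 := hadd (e₀ i * e₁ j - e₀ j * e₁ i) (e₀ j * e₁ i)
    rw [sub_add_cancel, mul_pow, mul_pow] at h1
    linear_combination h - h1
  set D := (e₀ i) ^ q * (e₁ j) ^ q - (e₀ j) ^ q * (e₁ i) ^ q with hDdef
  refine ⟨D⁻¹ • (Pi.single i (e₁ j ^ q) - Pi.single j (e₁ i ^ q)),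
    D⁻¹ • (Pi.single j (e₀ i ^ q) - Pi.single i (e₀ j ^ q)), ?_, ?_, ?_, ?_⟩ <;>
    simp only [hform_smul_left, hform_sub_left, hform_single_left]
  · rw [inv_mul_eq_one₀ hD, hDdef]
    ring
  · ring
  · ring
  · rw [inv_mul_eq_one₀ hD, hDdef]

/-- A basis of `F⁵` adapted to the totally isotropic line spanned by `e₀` and `e₁`. -/
structure AdaptedBasis (q : ℕ) (e₀ e₁ f₀ f₁ w : Fin 5 → F) : Prop where
  e₀e₀ : hform q e₀ e₀ = 0
  e₀e₁ : hform q e₀ e₁ = 0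
  e₁e₀ : hform q e₁ e₀ = 0
  e₁e₁ : hform q e₁ e₁ = 0
  f₀e₀ : hform q f₀ e₀ = 1
  f₀e₁ : hform q f₀ e₁ = 0
  f₁e₀ : hform q f₁ e₀ = 0
  f₁e₁ : hform q f₁ e₁ = 1
  e₀f₀ : hform q e₀ f₀ = 1
  e₀f₁ : hform q e₀ f₁ = 0
  e₁f₀ : hform q e₁ f₀ = 0
  e₁f₁ : hform q e₁ f₁ = 1
  we₀ : hform q w e₀ = 0
  we₁ : hform q w e₁ = 0
  wf₀ : hform q w f₀ = 0
  wf₁ : hform q w f₁ = 0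
  e₀w : hform q e₀ w = 0
  e₁w : hform q e₁ w = 0
  f₀w : hform q f₀ w = 0
  f₁w : hform q f₁ w = 0
  ww : hform q w w ≠ 0
  linearIndependent : LinearIndependent F ![e₀, e₁, f₀, f₁, w]

theorem exists_combination_of_linearIndependent {v : Fin 5 → Fin 5 → F}
    (hv : LinearIndependent F v) (u : Fin 5 → F) : ∃ c : Fin 5 → F, u = ∑ i, c i • v i := by
  have h := hv.span_eq_top_of_card_eq_finrank' (by simp)
  have hu : u ∈ Submodule.span F (Set.range v) := h ▸ Submodule.mem_top
  obtain ⟨c, hc⟩ := (Submodule.mem_span_range_iff_exists_fun F).1 hu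
  exact ⟨c, hc.symm⟩

theorem exists_adaptedBasis (hq : q ≠ 0) (hadd : ∀ x y : F, (x + y) ^ q = x ^ q + y ^ q)
    (hqq : ∀ x : F, (x ^ q) ^ q = x) {e₀ e₁ : Fin 5 → F} (he : LinearIndependent F ![e₀, e₁])
    (h₀₀ : hform q e₀ e₀ = 0) (h₁₁ : hform q e₁ e₁ = 0) (h₀₁ : hform q e₀ e₁ = 0)
    (h₁₀ : hform q e₁ e₀ = 0) : ∃ f₀ f₁ w, AdaptedBasis q e₀ e₁ f₀ f₁ w := by
  obtain ⟨f₀, f₁, f₀e₀, f₀e₁, f₁e₀, f₁e₁⟩ := exists_dual_pair hadd he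
  have hswap := hform_swap hq hadd hqq
  let L : (Fin 5 → F) → (Fin 5 → F) →ₗ[F] F := fun v =>
    { toFun := fun u => hform q u v
      map_add' := fun u u' => hform_add_left u u' v
      map_smul' := fun a u => hform_smul_left a u v }
  obtain ⟨w, hw, hw0⟩ := Submodule.exists_mem_ne_zero_of_ne_bot
    (LinearMap.ker_ne_bot_of_finrank_lt (f := LinearMap.pi ![L e₀, L e₁, L f₀, L f₁]) (by simp))
  have hw' := fun i => congrFun (LinearMap.mem_ker.1 hw) i
  have we₀ : hform q w e₀ = 0 := hw' 0
  have we₁ : hform q w e₁ = 0 := hw' 1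
  have wf₀ : hform q w f₀ = 0 := hw' 2
  have wf₁ : hform q w f₁ = 0 := hw' 3
  have e₀f₀ : hform q e₀ f₀ = 1 := by rw [← hswap, f₀e₀, one_pow]
  have e₀f₁ : hform q e₀ f₁ = 0 := by rw [← hswap, f₁e₀, zero_pow hq]
  have e₁f₀ : hform q e₁ f₀ = 0 := by rw [← hswap, f₀e₁, zero_pow hq]
  have e₁f₁ : hform q e₁ f₁ = 1 := by rw [← hswap, f₁e₁, one_pow]
  have e₀w : hform q e₀ w = 0 := by rw [← hswap, we₀, zero_pow hq]
  have e₁w : hform q e₁ w = 0 := by rw [← hswap, we₁, zero_pow hq]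
  have f₀w : hform q f₀ w = 0 := by rw [← hswap, wf₀, zero_pow hq]
  have f₁w : hform q f₁ w = 0 := by rw [← hswap, wf₁, zero_pow hq]
  have hli : LinearIndependent F ![e₀, e₁, f₀, f₁, w] := by
    rw [Fintype.linearIndependent_iff]
    intro g hg
    rw [Fin.sum_univ_five] at hg
    change g 0 • e₀ + g 1 • e₁ + g 2 • f₀ + g 3 • f₁ + g 4 • w = 0 at hg
    have hpair : ∀ v, hform q (g 0 • e₀ + g 1 • e₁ + g 2 • f₀ + g 3 • f₁ + g 4 • w) v = 0 := by
      intro v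
      rw [hg]
      simp [hform]
    simp only [hform_add_left, hform_smul_left] at hpair
    have g2 : g 2 = 0 := by
      have := hpair e₀
      rw [h₀₀, h₁₀, f₀e₀, f₁e₀, we₀] at this
      linear_combination this
    have g3 : g 3 = 0 := by
      have := hpair e₁
      rw [h₀₁, h₁₁, f₀e₁, f₁e₁, we₁] at this
      linear_combination this
    have g0 : g 0 = 0 := by
      have := hpair f₀
      rw [e₀f₀, e₁f₀, g2, g3, wf₀] at this
      linear_combination this
    have g1 : g 1 = 0 := by
      have := hpair f₁
      rw [e₀f₁, e₁f₁, g2, g3, wf₁] at this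
      linear_combination this
    have g4 : g 4 = 0 := by
      rw [g0, g1, g2, g3] at hg
      simpa [hw0] using hg
    intro i
    fin_cases i <;> assumption
  have ww : hform q w w ≠ 0 := by
    intro ww
    apply hw0
    ext i
    obtain ⟨c, hc⟩ := exists_combination_of_linearIndependent hli (Pi.single i 1)
    have h1 : hform q (Pi.single i 1) w = 0 := by
      rw [hc, Fin.sum_univ_five]
      change hform q (c 0 • e₀ + c 1 • e₁ + c 2 • f₀ + c 3 • f₁ + c 4 • w) w = 0
      simp only [hform_add_left, hform_smul_left, e₀w, e₁w, f₀w, f₁w, ww, mul_zero, add_zero]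
    rw [hform_single_left, one_mul] at h1
    exact eq_zero_of_pow_eq_zero h1
  exact ⟨f₀, f₁, w, h₀₀, h₀₁, h₁₀, h₁₁, f₀e₀, f₀e₁, f₁e₀, f₁e₁, e₀f₀, e₀f₁, e₁f₀, e₁f₁, we₀, we₁,
    wf₀, wf₁, e₀w, e₁w, f₀w, f₁w, ww, hli⟩

theorem AdaptedBasis.hform_self_combination {e₀ e₁ f₀ f₁ w : Fin 5 → F}
    (hb : AdaptedBasis q e₀ e₁ f₀ f₁ w) (hadd : ∀ x y : F, (x + y) ^ q = x ^ q + y ^ q)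
    (u : Fin 5 → F) :
    hform q (∑ i, u i • ![e₀, e₁, f₀, f₁, w] i) (∑ i, u i • ![e₀, e₁, f₀, f₁, w] i) =
      u 0 ^ q * u 2 + u 0 * u 2 ^ q + u 1 ^ q * u 3 + u 1 * u 3 ^ q +
        hform q (u 2 • f₀ + u 3 • f₁) (u 2 • f₀ + u 3 • f₁) + hform q w w * u 4 ^ (q + 1) := by
  have h : ∑ i, u i • ![e₀, e₁, f₀, f₁, w] i =
      u 0 • e₀ + u 1 • e₁ + u 2 • f₀ + u 3 • f₁ + u 4 • w := by
    rw [Fin.sum_univ_five]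
    rfl
  rw [h]
  simp only [hform_add_left, hform_smul_left, hform_add_right hadd, hform_smul_right, hb.e₀e₀,
    hb.e₀e₁, hb.e₁e₀, hb.e₁e₁, hb.f₀e₀, hb.f₀e₁, hb.f₁e₀, hb.f₁e₁, hb.e₀f₀, hb.e₀f₁, hb.e₁f₀,
    hb.e₁f₁, hb.we₀, hb.we₁, hb.wf₀, hb.wf₁, hb.e₀w, hb.e₁w, hb.f₀w, hb.f₁w]
  ring

end HermitianForm

section Subspaces

variable {F : Type} [Field F] {q : ℕ}

theorem eval_smul_of_isHomogeneous {G : MvPolynomial (Fin 5) F} (hG : G.IsHomogeneous 3)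
    (c : F) (u : Fin 5 → F) : eval (c • u) G = c ^ 3 * eval u G := by
  obtain ⟨a, ha⟩ := exists_forall_eval_eq_sum hG
  simp only [ha, Finset.mul_sum, Pi.smul_apply, smul_eq_mul]
  refine Finset.sum_congr rfl fun i _ => Finset.sum_congr rfl fun j _ =>
    Finset.sum_congr rfl fun k _ => ?_
  ring

theorem hform_smul_self (c : F) (u : Fin 5 → F) :
    hform q (c • u) (c • u) = c * c ^ q * hform q u u := by
  rw [hform_smul_left, hform_smul_right, mul_assoc]

theorem isLinSub_setOf_submodule_le {k : ℕ} {W : Submodule F (Fin 5 → F)}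
    (hW : Module.finrank F W = k) : IsLinSub F k {x | x.submodule ≤ W} :=
  ⟨W, hW, rfl⟩

theorem rep_mem_submodule (x : P4 F) : x.rep ∈ x.submodule := by
  rw [Projectivization.submodule_eq]
  exact Submodule.mem_span_singleton_self _

theorem setOf_submodule_le_subset_VG {G : MvPolynomial (Fin 5) F} {W : Submodule F (Fin 5 → F)}
    (h : ∀ u ∈ W, eval u G = 0) : {x : P4 F | x.submodule ≤ W} ⊆ VG G :=
  fun x hx => h _ (hx (rep_mem_submodule x))

theorem setOf_submodule_le_subset_hermV3 {W : Submodule F (Fin 5 → F)}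
    (h : ∀ u ∈ W, hform q u u = 0) : {x : P4 F | x.submodule ≤ W} ⊆ hermV3 q F :=
  fun x hx => (hform_self x.rep).symm.trans (h _ (hx (rep_mem_submodule x)))

theorem exists_eq_smul_rep {W : Submodule F (Fin 5 → F)} {u : Fin 5 → F} (hu : u ∈ W)
    (hu0 : u ≠ 0) : ∃ x : P4 F, x.submodule ≤ W ∧ ∃ c : F, u = c • x.rep := by
  refine ⟨Projectivization.mk F u hu0, ?_, ?_⟩
  · rw [Projectivization.submodule_mk, Submodule.span_singleton_le_iff_mem]
    exact hu
  · have h : u ∈ (Projectivization.mk F u hu0).submodule := by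
      rw [Projectivization.submodule_mk]
      exact Submodule.mem_span_singleton_self u
    rw [Projectivization.submodule_eq, Submodule.mem_span_singleton] at h
    obtain ⟨c, hc⟩ := h
    exact ⟨c, hc.symm⟩

theorem submodule_le_of_setOf_eq {W W' : Submodule F (Fin 5 → F)}
    (h : {x : P4 F | x.submodule ≤ W} = {x | x.submodule ≤ W'}) : W ≤ W' := by
  intro u hu
  by_cases hu0 : u = 0
  · exact hu0 ▸ W'.zero_mem
  obtain ⟨x, hx, c, hc⟩ := exists_eq_smul_rep hu hu0
  have hx' : x.submodule ≤ W' := h.subset hx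
  exact hc ▸ W'.smul_mem c (hx' (rep_mem_submodule x))

theorem eval_eq_zero_of_setOf_subset {G : MvPolynomial (Fin 5) F} (hG : G.IsHomogeneous 3)
    {W : Submodule F (Fin 5 → F)} (h : {x : P4 F | x.submodule ≤ W} ⊆ VG G) {u : Fin 5 → F}
    (hu : u ∈ W) : eval u G = 0 := by
  by_cases hu0 : u = 0
  · have := eval_smul_of_isHomogeneous hG 0 u
    simpa [hu0] using this
  obtain ⟨x, hx, c, hc⟩ := exists_eq_smul_rep hu hu0
  rw [hc, eval_smul_of_isHomogeneous hG, show eval x.rep G = 0 from h hx, mul_zero]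

theorem hform_eq_zero_of_setOf_subset {W : Submodule F (Fin 5 → F)}
    (h : {x : P4 F | x.submodule ≤ W} ⊆ hermV3 q F) {u : Fin 5 → F} (hu : u ∈ W) :
    hform q u u = 0 := by
  by_cases hu0 : u = 0
  · simp [hu0, hform]
  obtain ⟨x, hx, c, hc⟩ := exists_eq_smul_rep hu hu0
  rw [hc, hform_smul_self, hform_self, show ∑ i, x.rep i ^ (q + 1) = 0 from h hx, mul_zero]

theorem finrank_span_pair {u v : Fin 5 → F}
    (h : ∀ a b : F, a • u + b • v = 0 → a = 0 ∧ b = 0) :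
    Module.finrank F (Submodule.span F {u, v}) = 2 := by
  have := finrank_span_eq_card (LinearIndependent.pair_iff.2 h)
  rwa [Matrix.range_cons_cons_empty, Fintype.card_fin] at this

theorem finrank_span_triple {u v w : Fin 5 → F}
    (h : ∀ a b c : F, a • u + b • v + c • w = 0 → a = 0 ∧ b = 0 ∧ c = 0) :
    Module.finrank F (Submodule.span F {u, v, w}) = 3 := by
  have hli : LinearIndependent F ![u, v, w] := by
    rw [Fintype.linearIndependent_iff]
    intro g hg
    rw [Fin.sum_univ_three] at hg
    obtain ⟨h0, h1, h2⟩ := h _ _ _ hg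
    intro i
    fin_cases i <;> assumption
  have := finrank_span_eq_card hli
  rwa [Matrix.range_cons, Matrix.range_cons_cons_empty, Set.singleton_union, Fintype.card_fin]
    at this

theorem ncard_le_card_of_forall_exists_smul {ι : Type} (S : Set (P4 F)) (T : Finset ι)
    (v : ι → Fin 5 → F) (h : ∀ x ∈ S, ∃ i ∈ T, ∃ c : F, x.rep = c • v i) : S.ncard ≤ T.card := by
  rcases S.eq_empty_or_nonempty with rfl | ⟨x₀, hx₀⟩
  · simp
  have : Nonempty ι := ⟨(h x₀ hx₀).choose⟩
  rw [← Set.ncard_coe_finset T]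
  choose! f hfT c hc using h
  refine Set.ncard_le_ncard_of_injOn f hfT (fun x hx y hy hxy => ?_) T.finite_toSet
  have hcy : c y ≠ 0 := by
    intro h0
    exact y.rep_nonzero (by rw [hc y hy, h0, zero_smul])
  rw [← x.mk_rep, ← y.mk_rep, Projectivization.mk_eq_mk_iff']
  refine ⟨c x * (c y)⁻¹, ?_⟩
  rw [hc y hy, hc x hx, hxy, smul_smul, inv_mul_cancel_right₀ hcy]

theorem eval_span_triple_eq_zero {G : MvPolynomial (Fin 5) F} (hG : G.IsHomogeneous 3)
    {p r v : Fin 5 → F} (hline : ∀ s t : F, eval (s • p + t • r) G = 0)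
    (hv : ∀ x z : F, eval (z • p + x • r + v) G = 0) {u : Fin 5 → F}
    (hu : u ∈ Submodule.span F {p, r, v}) : eval u G = 0 := by
  obtain ⟨a, b, c, rfl⟩ := Submodule.mem_span_triple.1 hu
  by_cases hc : c = 0
  · rw [hc, zero_smul, add_zero]
    exact hline a b
  · have : a • p + b • r + c • v = c • ((a / c) • p + (b / c) • r + v) := by
      simp only [smul_add, smul_smul, mul_div_cancel₀ _ hc]
    rw [this, eval_smul_of_isHomogeneous hG, hv, mul_zero]

theorem eq_of_vanish_on_pencil {G : MvPolynomial (Fin 5) F} (hG : G.IsHomogeneous 3)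
    (htwo : ∀ Pl : Set (P4 F), IsPlane F Pl →
      ∀ g₁ g₂ g₃ : Set (P4 F), IsLine F g₁ → IsLine F g₂ → IsLine F g₃ →
        g₁ ⊆ hermV3 q F → g₂ ⊆ hermV3 q F → g₃ ⊆ hermV3 q F →
        g₁ ⊆ Pl ∩ VG G → g₂ ⊆ Pl ∩ VG G → g₃ ⊆ Pl ∩ VG G →
        g₁ = g₂ ∨ g₁ = g₃ ∨ g₂ = g₃)
    {p r v : Fin 5 → F}
    (hli : ∀ a b c : F, a • p + b • r + c • v = 0 → a = 0 ∧ b = 0 ∧ c = 0)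
    (hline : ∀ s t : F, eval (s • p + t • r) G = 0)
    (hline' : ∀ s t : F, hform q (s • p + t • r) (s • p + t • r) = 0)
    {x x' : F} (hx : ∀ z : F, eval (z • p + x • r + v) G = 0)
    (hx' : ∀ z : F, eval (z • p + x' • r + v) G = 0)
    (hhx : ∀ z : F, hform q (z • p + x • r + v) (z • p + x • r + v) = 0)
    (hhx' : ∀ z : F, hform q (z • p + x' • r + v) (z • p + x' • r + v) = 0) : x = x' := by
  let U : Submodule F (Fin 5 → F) := Submodule.span F {p, r}
  let W : F → Submodule F (Fin 5 → F) := fun x => Submodule.span F {p, x • r + v}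
  have hU : Module.finrank F U = 2 := finrank_span_pair fun a b h => by
    have := hli a b 0 (by rw [zero_smul, add_zero, h])
    exact ⟨this.1, this.2.1⟩
  have hW : ∀ x, Module.finrank F (W x) = 2 := fun x => finrank_span_pair fun a b h => by
    have := hli a (b * x) b (by rw [← h]; module)
    exact ⟨this.1, this.2.2⟩
  have hUle : U ≤ Submodule.span F {p, r, v} := Submodule.span_mono (by
    rintro u (rfl | rfl) <;> simp)
  have hWle : ∀ x, W x ≤ Submodule.span F {p, r, v} := fun x => Submodule.span_le.2 (by
    rintro u (rfl | rfl)
    · exact Submodule.subset_span (by simp)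
    · exact Submodule.mem_span_triple.2 ⟨0, x, 1, by module⟩)
  have hsmul : ∀ x s t : F, t ≠ 0 → s • p + t • (x • r + v) = t • ((s / t) • p + x • r + v) := by
    intro x s t ht
    simp only [smul_add, smul_smul, mul_div_cancel₀ _ ht, add_assoc]
  have hWG : ∀ x, (∀ z : F, eval (z • p + x • r + v) G = 0) → ∀ u ∈ W x, eval u G = 0 := by
    intro x hx u hu
    obtain ⟨s, t, rfl⟩ := Submodule.mem_span_pair.1 hu
    by_cases ht : t = 0
    · simpa [ht] using hline s 0
    · rw [hsmul x s t ht, eval_smul_of_isHomogeneous hG, hx, mul_zero]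
  have hWH : ∀ x, (∀ z : F, hform q (z • p + x • r + v) (z • p + x • r + v) = 0) →
      ∀ u ∈ W x, hform q u u = 0 := by
    intro x hx u hu
    obtain ⟨s, t, rfl⟩ := Submodule.mem_span_pair.1 hu
    by_cases ht : t = 0
    · simpa [ht] using hline' s 0
    · rw [hsmul x s t ht, hform_smul_self, hx, mul_zero]
  have hUG : ∀ u ∈ U, eval u G = 0 := by
    intro u hu
    obtain ⟨s, t, rfl⟩ := Submodule.mem_span_pair.1 hu
    exact hline s t
  have hUH : ∀ u ∈ U, hform q u u = 0 := by
    intro u hu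
    obtain ⟨s, t, rfl⟩ := Submodule.mem_span_pair.1 hu
    exact hline' s t
  have hUW : ∀ x, ¬ W x ≤ U := by
    intro x h
    have hm : x • r + v ∈ U := h (Submodule.subset_span (by simp))
    obtain ⟨s, t, hst⟩ := Submodule.mem_span_pair.1 hm
    have := hli s (t - x) (-1) (by
      have h0 : s • p + t • r - (x • r + v) = 0 := sub_eq_zero.2 hst
      rw [← h0]
      module)
    exact neg_ne_zero.2 one_ne_zero this.2.2
  have hsub : ∀ {A : Submodule F (Fin 5 → F)}, A ≤ Submodule.span F {p, r, v} →
      (∀ u ∈ A, eval u G = 0) →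
      {y : P4 F | y.submodule ≤ A} ⊆ {y : P4 F | y.submodule ≤ Submodule.span F {p, r, v}} ∩ VG G :=
    fun hA hAG => Set.subset_inter (fun y hy => le_trans hy hA) (setOf_submodule_le_subset_VG hAG)
  rcases htwo _ (isLinSub_setOf_submodule_le (finrank_span_triple hli)) _ _ _
    (isLinSub_setOf_submodule_le hU) (isLinSub_setOf_submodule_le (hW x))
    (isLinSub_setOf_submodule_le (hW x')) (setOf_submodule_le_subset_hermV3 hUH)
    (setOf_submodule_le_subset_hermV3 (hWH x hhx)) (setOf_submodule_le_subset_hermV3 (hWH x' hhx'))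
    (hsub hUle hUG) (hsub (hWle x) (hWG x hx)) (hsub (hWle x') (hWG x' hx')) with h | h | h
  · exact absurd (submodule_le_of_setOf_eq h.symm) (hUW x)
  · exact absurd (submodule_le_of_setOf_eq h.symm) (hUW x')
  · have hm : x • r + v ∈ W x' := submodule_le_of_setOf_eq h (Submodule.subset_span (by simp))
    obtain ⟨s, t, hst⟩ := Submodule.mem_span_pair.1 hm
    obtain ⟨-, h1, h2⟩ := hli s (t * x' - x) (t - 1) (by
      have h0 : s • p + t • (x' • r + v) - (x • r + v) = 0 := sub_eq_zero.2 hst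
      rw [← h0]
      module)
    linear_combination x' * h2 - h1

end Subspaces

section PencilVectors

variable {F : Type} [Field F] {q : ℕ} {e₀ e₁ f₀ f₁ w : Fin 5 → F}

/-- The point of the line spanned by `e₀` and `e₁` with a given parameter. -/
def axisVec (e₀ e₁ : Fin 5 → F) : Option F → Fin 5 → F
  | none => e₁
  | some t => e₀ + t • e₁

/-- A second point of the line spanned by `e₀` and `e₁`. -/
def crossVec (e₀ e₁ : Fin 5 → F) : Option F → Fin 5 → F
  | none => e₀
  | some _ => e₁

/-- A vector that, together with `e₀`, `e₁` and `w`, spans the tangent hyperplane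
at `axisVec e₀ e₁ P`. -/
def liftVec (q : ℕ) (f₀ f₁ : Fin 5 → F) : Option F → Fin 5 → F
  | none => f₀
  | some t => t ^ q • f₀ - f₁

/-- The polynomial describing the Hermitian variety in the tangent hyperplane
at `axisVec e₀ e₁ P`. -/
def hermPoly (q : ℕ) (f₀ f₁ w : Fin 5 → F) (P : Option F) : Polynomial F :=
  Polynomial.C (P.elim (-1) (fun _ => 1) * hform q (liftVec q f₀ f₁ P) (liftVec q f₀ f₁ P)) +
    Polynomial.C (P.elim (-1) (fun _ => 1) * hform q w w) * Polynomial.X ^ (q + 1)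

theorem natDegree_hermPoly (hw : hform q w w ≠ 0) (P : Option F) :
    (hermPoly q f₀ f₁ w P).natDegree = q + 1 := by
  have hP : P.elim (-1 : F) (fun _ => 1) ≠ 0 := by cases P <;> simp
  rw [hermPoly, Polynomial.natDegree_C_add,
    Polynomial.natDegree_C_mul_X_pow _ _ (mul_ne_zero hP hw)]

theorem AdaptedBasis.hform_self_add (hb : AdaptedBasis q e₀ e₁ f₀ f₁ w)
    (hadd : ∀ x y : F, (x + y) ^ q = x ^ q + y ^ q) (x₀ x₁ y₀ y₁ y₂ : F) :
    hform q (x₀ • e₀ + x₁ • e₁ + y₀ • f₀ + y₁ • f₁ + y₂ • w)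
      (x₀ • e₀ + x₁ • e₁ + y₀ • f₀ + y₁ • f₁ + y₂ • w) =
      x₀ ^ q * y₀ + x₀ * y₀ ^ q + x₁ ^ q * y₁ + x₁ * y₁ ^ q +
        hform q (y₀ • f₀ + y₁ • f₁) (y₀ • f₀ + y₁ • f₁) + hform q w w * y₂ ^ (q + 1) := by
  have := hb.hform_self_combination hadd ![x₀, x₁, y₀, y₁, y₂]
  rw [Fin.sum_univ_five] at this
  exact this

theorem pencilVec_none (x y z : F) :
    z • axisVec e₀ e₁ none + x • crossVec e₀ e₁ none + (liftVec q f₀ f₁ none + y • w) =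
      x • e₀ + z • e₁ + (1 : F) • f₀ + (0 : F) • f₁ + y • w := by
  simp only [axisVec, crossVec, liftVec]
  module

theorem pencilVec_some (t x y z : F) :
    z • axisVec e₀ e₁ (some t) + x • crossVec e₀ e₁ (some t) +
      (liftVec q f₀ f₁ (some t) + y • w) =
      z • e₀ + (z * t + x) • e₁ + t ^ q • f₀ + (-1 : F) • f₁ + y • w := by
  simp only [axisVec, crossVec, liftVec]
  module

theorem AdaptedBasis.hform_pencilVec_eq_zero_iff (hb : AdaptedBasis q e₀ e₁ f₀ f₁ w) (hq : q ≠ 0)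
    (hadd : ∀ x y : F, (x + y) ^ q = x ^ q + y ^ q) (hqq : ∀ x : F, (x ^ q) ^ q = x)
    (P : Option F) (x y z : F) :
    hform q (z • axisVec e₀ e₁ P + x • crossVec e₀ e₁ P + (liftVec q f₀ f₁ P + y • w))
      (z • axisVec e₀ e₁ P + x • crossVec e₀ e₁ P + (liftVec q f₀ f₁ P + y • w)) = 0 ↔
      x ^ q + x = (hermPoly q f₀ f₁ w P).eval y := by
  rw [← sub_eq_zero (a := x ^ q + x)]
  cases P with
  | none =>
    have hl : liftVec q f₀ f₁ none = (1 : F) • f₀ + (0 : F) • f₁ := by simp [liftVec]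
    rw [pencilVec_none, hb.hform_self_add hadd]
    simp only [hermPoly, hl, Polynomial.eval_add, Polynomial.eval_mul, Polynomial.eval_C,
      Polynomial.eval_pow, Polynomial.eval_X, Option.elim_none, one_pow, zero_pow hq]
    refine Eq.congr_left ?_
    ring
  | some t =>
    have hl : liftVec q f₀ f₁ (some t) = t ^ q • f₀ + (-1 : F) • f₁ := by
      simp [liftVec, sub_eq_add_neg]
    rw [pencilVec_some, hb.hform_self_add hadd, ← neg_eq_zero]
    simp only [hermPoly, hl, Polynomial.eval_add, Polynomial.eval_mul, Polynomial.eval_C,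
      Polynomial.eval_pow, Polynomial.eval_X, Option.elim_some, neg_one_pow_of_add_pow hq hadd,
      hqq, hadd, mul_pow]
    refine Eq.congr_left ?_
    ring

theorem pencilVec_linearIndependent (hli : LinearIndependent F ![e₀, e₁, f₀, f₁, w])
    (P : Option F) (y α β γ : F)
    (h : α • axisVec e₀ e₁ P + β • crossVec e₀ e₁ P + γ • (liftVec q f₀ f₁ P + y • w) = 0) :
    α = 0 ∧ β = 0 ∧ γ = 0 := by
  have key : ∀ x₀ x₁ y₀ y₁ y₂ : F, x₀ • e₀ + x₁ • e₁ + y₀ • f₀ + y₁ • f₁ + y₂ • w = 0 →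
      x₀ = 0 ∧ x₁ = 0 ∧ y₀ = 0 ∧ y₁ = 0 := by
    intro x₀ x₁ y₀ y₁ y₂ h0
    have := Fintype.linearIndependent_iff.1 hli ![x₀, x₁, y₀, y₁, y₂] (by
      rw [Fin.sum_univ_five]
      exact h0)
    exact ⟨this 0, this 1, this 2, this 3⟩
  cases P with
  | none =>
    obtain ⟨h0, h1, h2, -⟩ := key β α γ 0 (γ * y) (by
      rw [← h]
      simp only [axisVec, crossVec, liftVec]
      module)
    exact ⟨h1, h0, h2⟩
  | some t =>
    obtain ⟨h0, h1, -, h3⟩ := key α (α * t + β) (γ * t ^ q) (-γ) (γ * y) (by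
      rw [← h]
      simp only [axisVec, crossVec, liftVec]
      module)
    refine ⟨h0, ?_, neg_eq_zero.1 h3⟩
    simpa [h0] using h1

theorem AdaptedBasis.exists_eq_smul_of_isotropic (hb : AdaptedBasis q e₀ e₁ f₀ f₁ w) (hq : q ≠ 0)
    (hadd : ∀ x y : F, (x + y) ^ q = x ^ q + y ^ q) (hqq : ∀ x : F, (x ^ q) ^ q = x)
    {u : Fin 5 → F} (hu : hform q u u = 0) :
    (∃ (P : Option F) (c : F), u = c • axisVec e₀ e₁ P) ∨
      ∃ (P : Option F) (y x z c : F), u = c •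
        (z • axisVec e₀ e₁ P + x • crossVec e₀ e₁ P + (liftVec q f₀ f₁ P + y • w)) := by
  obtain ⟨c, hc⟩ := exists_combination_of_linearIndependent hb.linearIndependent u
  rw [Fin.sum_univ_five] at hc
  change u = c 0 • e₀ + c 1 • e₁ + c 2 • f₀ + c 3 • f₁ + c 4 • w at hc
  generalize c 0 = x₀ at hc
  generalize c 1 = x₁ at hc
  generalize c 2 = y₀ at hc
  generalize c 3 = y₁ at hc
  generalize c 4 = y₂ at hc
  by_cases hy₁ : y₁ = 0
  · by_cases hy₀ : y₀ = 0
    · left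
      have hy₂ : y₂ = 0 := by
        rw [hc, hb.hform_self_add hadd, hy₀, hy₁] at hu
        have h0 : hform q w w * y₂ ^ (q + 1) = 0 := by
          simpa [zero_pow hq, hform] using hu
        exact eq_zero_of_pow_eq_zero ((mul_eq_zero.1 h0).resolve_left hb.ww)
      rw [hy₀, hy₁, hy₂] at hc
      by_cases hx₀ : x₀ = 0
      · refine ⟨none, x₁, ?_⟩
        rw [hc, hx₀, axisVec]
        module
      · refine ⟨some (x₁ / x₀), x₀, ?_⟩
        rw [hc, axisVec, smul_add, smul_smul, mul_div_cancel₀ _ hx₀]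
        module
    · refine .inr ⟨none, y₂ / y₀, x₀ / y₀, x₁ / y₀, y₀, ?_⟩
      rw [pencilVec_none, hc, hy₁]
      simp only [smul_add, smul_smul, mul_div_cancel₀ _ hy₀, mul_one, mul_zero]
  · have hn : -y₁ ≠ 0 := neg_ne_zero.2 hy₁
    refine .inr ⟨some ((y₀ / -y₁) ^ q), y₂ / -y₁, x₁ / -y₁ - x₀ / -y₁ * (y₀ / -y₁) ^ q,
      x₀ / -y₁, -y₁, ?_⟩
    rw [pencilVec_some, hc, hqq]
    simp only [smul_add, smul_smul, mul_div_cancel₀ _ hn, add_sub_cancel, mul_neg, mul_one,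
      neg_neg]

theorem exists_eval_pencilVec_eq_pencilForm {G : MvPolynomial (Fin 5) F} (hG : G.IsHomogeneous 3)
    (hline : ∀ s t : F, eval (s • e₀ + t • e₁) G = 0) :
    ∃ (a b d : Fin 3 → F) (r s : Fin 6 → F) (K : F → F → F → F),
      (∀ y₀ y₁, ∃ k : Polynomial F, k.natDegree ≤ 3 ∧ ∀ y, K y₀ y₁ y = k.eval y) ∧
      ∀ P y x z, eval (z • axisVec e₀ e₁ P + x • crossVec e₀ e₁ P + (liftVec q f₀ f₁ P + y • w)) G =
        pencilForm q (cubicForm a b d r s K) P y x z := by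
  obtain ⟨c, hc⟩ := exists_forall_eval_combination_eq_sum hG ![e₀, e₁, f₀, f₁, w]
  have hc' : ∀ x₀ x₁ y₀ y₁ y₂ : F,
      eval (x₀ • e₀ + x₁ • e₁ + y₀ • f₀ + y₁ • f₁ + y₂ • w) G =
        ∑ i, ∑ j, ∑ k, c i j k * ((![x₀, x₁, y₀, y₁, y₂] : Fin 5 → F) i *
          (![x₀, x₁, y₀, y₁, y₂] : Fin 5 → F) j * (![x₀, x₁, y₀, y₁, y₂] : Fin 5 → F) k) := by
    intro x₀ x₁ y₀ y₁ y₂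
    rw [← hc, Fin.sum_univ_five]
    rfl
  obtain ⟨a, b, d, r, s, K, hK, hform⟩ := exists_cubicForm_eq c fun x₀ x₁ => by
    rw [← hc']
    simpa using hline x₀ x₁
  refine ⟨a, b, d, r, s, K, hK, fun P y x z => ?_⟩
  cases P with
  | none => rw [pencilVec_none, hc', hform, pencilForm]
  | some t => rw [pencilVec_some, hc', hform, pencilForm]

end PencilVectors

section Counting

variable {F : Type} [Field F] [Fintype F] {q : ℕ} {e₀ e₁ f₀ f₁ w : Fin 5 → F}

theorem AdaptedBasis.ncard_le_sum_slabCount (hb : AdaptedBasis q e₀ e₁ f₀ f₁ w) (hq : q ≠ 0)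
    (hF : Fintype.card F = q ^ 2)
    (hadd : ∀ x y : F, (x + y) ^ q = x ^ q + y ^ q) (hqq : ∀ x : F, (x ^ q) ^ q = x)
    {G : MvPolynomial (Fin 5) F} (hG : G.IsHomogeneous 3) (f : Option F → F → F → F → F)
    (hf : ∀ P y x z, eval
      (z • axisVec e₀ e₁ P + x • crossVec e₀ e₁ P + (liftVec q f₀ f₁ P + y • w)) G = f P y x z) :
    (VG G ∩ hermV3 q F).ncard ≤
      ∑ P, slabCount q (fun y => (hermPoly q f₀ f₁ w P).eval y) (f P) + (q ^ 2 + 1) := by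
  classical
  let T : Finset (Option F ⊕ Σ _ : Option F, Σ _ : F, Σ _ : F, F) :=
    Finset.univ.disjSum (Finset.univ.sigma fun P => Finset.univ.sigma fun y =>
      ({x | x ^ q + x = (hermPoly q f₀ f₁ w P).eval y} : Finset F).sigma fun x =>
        {z | f P y x z = 0})
  have hT : T.card = ∑ P, slabCount q (fun y => (hermPoly q f₀ f₁ w P).eval y) (f P) +
      (q ^ 2 + 1) := by
    simp only [T, Finset.card_disjSum, Finset.card_sigma, Finset.card_univ, Fintype.card_option,
      hF, slabCount]
    rw [add_comm]
  rw [← hT]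
  refine ncard_le_card_of_forall_exists_smul _ T (Sum.elim (axisVec e₀ e₁) fun i =>
    i.2.2.2 • axisVec e₀ e₁ i.1 + i.2.2.1 • crossVec e₀ e₁ i.1 +
      (liftVec q f₀ f₁ i.1 + i.2.1 • w)) fun p hp => ?_
  have hpG : eval p.rep G = 0 := hp.1
  have hpH : hform q p.rep p.rep = 0 := (hform_self p.rep).trans hp.2
  rcases hb.exists_eq_smul_of_isotropic hq hadd hqq hpH with ⟨P, c, hc⟩ | ⟨P, y, x, z, c, hc⟩
  · exact ⟨.inl P, by simp [T], c, hc⟩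
  · refine ⟨.inr ⟨P, y, x, z⟩, ?_, c, hc⟩
    have hc0 : c ≠ 0 := by
      rintro rfl
      exact p.rep_nonzero (by rw [hc, zero_smul])
    rw [hc, eval_smul_of_isHomogeneous hG, hf] at hpG
    rw [hc, hform_smul_self] at hpH
    have hx := (hb.hform_pencilVec_eq_zero_iff hq hadd hqq P x y z).1
      ((mul_eq_zero.1 hpH).resolve_left (mul_ne_zero hc0 (pow_ne_zero _ hc0)))
    have hz := (mul_eq_zero.1 hpG).resolve_left (pow_ne_zero _ hc0)
    simp [T, hx, hz]

theorem even_of_card_eq_sq (hF : Fintype.card F = q ^ 2) (h : (2 : F) = 0) : Even q := by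
  have hchar : ringChar F = 2 := by
    have := (ringChar.spec F 2).1 (by exact_mod_cast h)
    rcases (Nat.dvd_prime Nat.prime_two).1 this with h1 | h1
    · exact absurd h1 (CharP.ringChar_ne_one)
    · exact h1
  have h2 := FiniteField.even_card_iff_char_two.1 hchar
  rw [hF, ← Nat.even_iff, Nat.even_pow] at h2
  exact h2.1

end Counting

theorem stmt18 (q : ℕ) (hq : IsPrimePow q) (hq7 : 7 ≤ q)
    (F : Type) [Field F] [Fintype F] (hF : Fintype.card F = q ^ 2)
    (G : MvPolynomial (Fin 5) F) (hG : G ≠ 0) (hGd : G.IsHomogeneous 3)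
    (hgen : ∃ ℓ : Set (P4 F), IsLine F ℓ ∧ ℓ ⊆ hermV3 q F ∧ ℓ ⊆ VG G)
    (hnoplane : ∀ S : Set (P4 F), IsPlane F S → ¬ S ⊆ VG G)
    (htwo : ∀ Pl : Set (P4 F), IsPlane F Pl →
      ∀ g₁ g₂ g₃ : Set (P4 F), IsLine F g₁ → IsLine F g₂ → IsLine F g₃ →
        g₁ ⊆ hermV3 q F → g₂ ⊆ hermV3 q F → g₃ ⊆ hermV3 q F →
        g₁ ⊆ Pl ∩ VG G → g₂ ⊆ Pl ∩ VG G → g₃ ⊆ Pl ∩ VG G →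
        g₁ = g₂ ∨ g₁ = g₃ ∨ g₂ = g₃) :
    (VG G ∩ hermV3 q F).ncard < 3 * (q ^ 5 + q ^ 2) + q ^ 3 + 1 := by
  have hq0 : q ≠ 0 := by omega
  have hadd := add_pow_of_card_eq_sq hq hF
  have hqq := pow_pow_of_card_eq_sq (F := F) hF
  obtain ⟨_, ⟨W, hW, rfl⟩, hℓH, hℓG⟩ := hgen
  let B := Module.finBasisOfFinrankEq F W hW
  let e₀ : Fin 5 → F := B 0
  let e₁ : Fin 5 → F := B 1
  have he : LinearIndependent F ![e₀, e₁] := by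
    have := B.linearIndependent.map' W.subtype W.ker_subtype
    have hB : W.subtype ∘ B = ![e₀, e₁] := by
      ext i
      fin_cases i <;> rfl
    rwa [hB] at this
  have hmem : ∀ s t : F, s • e₀ + t • e₁ ∈ W := fun s t =>
    W.add_mem (W.smul_mem s (B 0).2) (W.smul_mem t (B 1).2)
  have hlineG : ∀ s t : F, eval (s • e₀ + t • e₁) G = 0 := fun s t =>
    eval_eq_zero_of_setOf_subset hGd hℓG (hmem s t)
  have hlineH : ∀ s t : F, hform q (s • e₀ + t • e₁) (s • e₀ + t • e₁) = 0 := fun s t =>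
    hform_eq_zero_of_setOf_subset hℓH (hmem s t)
  have haxis : ∀ (P : Option F) (s t : F),
      ∃ s' t' : F, s • axisVec e₀ e₁ P + t • crossVec e₀ e₁ P = s' • e₀ + t' • e₁ := by
    rintro (_ | m) s t
    · exact ⟨t, s, add_comm _ _⟩
    · refine ⟨s, s * m + t, ?_⟩
      simp only [axisVec, crossVec]
      module
  have haxisG : ∀ (P : Option F) (s t : F),
      eval (s • axisVec e₀ e₁ P + t • crossVec e₀ e₁ P) G = 0 := fun P s t => by
    obtain ⟨s', t', h⟩ := haxis P s t
    rw [h, hlineG]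
  have haxisH : ∀ (P : Option F) (s t : F),
      hform q (s • axisVec e₀ e₁ P + t • crossVec e₀ e₁ P)
        (s • axisVec e₀ e₁ P + t • crossVec e₀ e₁ P) = 0 := fun P s t => by
    obtain ⟨s', t', h⟩ := haxis P s t
    rw [h, hlineH]
  obtain ⟨h₀₀, h₁₁, h₀₁, h₁₀⟩ :=
    hform_eq_zero_of_forall_isotropic (by omega) hF hadd hqq hlineH
  obtain ⟨f₀, f₁, w, hb⟩ := exists_adaptedBasis hq0 hadd hqq he h₀₀ h₁₁ h₀₁ h₁₀
  obtain ⟨a, b, d, r, s, K, hK, hf⟩ :=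
    exists_eval_pencilVec_eq_pencilForm (q := q) (f₀ := f₀) (f₁ := f₁) (w := w) hGd hlineG
  refine (hb.ncard_le_sum_slabCount hq0 hF hadd hqq hGd _ hf).trans_lt ?_
  refine sum_slabCount_lt hq7 hF (even_of_card_eq_sq hF) _ (natDegree_hermPoly hb.ww) hK ?_ ?_
  · intro P y x x' hx hx' hz hz'
    exact eq_of_vanish_on_pencil hGd htwo (pencilVec_linearIndependent hb.linearIndependent P y)
      (haxisG P) (haxisH P) (fun z => (hf P y x z).trans (hz z))
      (fun z => (hf P y x' z).trans (hz' z))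
      (fun z => (hb.hform_pencilVec_eq_zero_iff hq0 hadd hqq P x y z).2 hx)
      (fun z => (hb.hform_pencilVec_eq_zero_iff hq0 hadd hqq P x' y z).2 hx')
  · intro P y
    by_contra! hzero
    exact hnoplane _ (isLinSub_setOf_submodule_le
      (finrank_span_triple (pencilVec_linearIndependent hb.linearIndependent P y)))
      (setOf_submodule_le_subset_VG fun u => eval_span_triple_eq_zero hGd (haxisG P)
        fun x z => (hf P y x z).trans (hzero x z))
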